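/- Let d = 2 and let b = ρΦ ∈ C¹_♯(Y₂)², where ρ ∈ C¹_♯(Y₂) is nonnegative and not identically zero, Φ = a R⊥∇u with a ∈ C¹_♯(Y₂) positive, u ∈ C²(ℝ²) with ∇u ∈ C¹_♯(Y₂)² nowhere vanishing, and suppose the ergodicity condition (∫_{Y₂} ∇u(y) dy)·κ ≠ 0 holds for every κ ∈ ℤ²∖{0}. Let m := (∫_{Y₂} dy/(a(y)ρ(y)))^{-1} ∈ [0,∞) be the harmonic mean of aρ. Then: (i) if ρ is positive everywhere, then for every x ∈ ℝ², X(t,x)/t → m ∫_{Y₂} R⊥∇u(y) dy as t → ∞; (ii) if ρ vanishes at some point and m = 0, then for every x ∈ ℝ², X(t,x)/t → 0; (iii) if ρ vanishes at some point and m > 0, then C_b = [0,ζ] := {sζ : s ∈ [0,1]} with ζ := m ∫_{Y₂} R⊥∇u(y) dy ≠ 0. -/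

import Mathlib

open MeasureTheory Filter Matrix

noncomputable section

/-- A function on `ℝ^d` is `ℤ^d`-periodic. -/
def ZdPeriodic {d : ℕ} {E : Type*} (f : (Fin d → ℝ) → E) : Prop :=
  ∀ (κ : Fin d → ℤ) (x : Fin d → ℝ), f (x + fun i => (κ i : ℝ)) = f x

/-- The unit cube `[0,1)^d`, a fundamental domain for the torus `Y_d = ℝ^d/ℤ^d`. -/
def unitCube (d : ℕ) : Set (Fin d → ℝ) := {x | ∀ i, x i ∈ Set.Ico (0 : ℝ) 1}

/-- `X` is the global flow of the vector field `b`: `∂X/∂t(t,x) = b(X(t,x))`, `X(0,x) = x`. -/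
def IsFlowOf {d : ℕ} (b : (Fin d → ℝ) → (Fin d → ℝ))
    (X : ℝ → (Fin d → ℝ) → (Fin d → ℝ)) : Prop :=
  ∀ x : Fin d → ℝ, X 0 x = x ∧ ∀ t : ℝ, HasDerivAt (fun s => X s x) (b (X t x)) t

/-- A measure `μ` on the torus `Y_d` (identified with a measure on `ℝ^d` carried by the unit
cube) is invariant for the flow `X`: `∫ ψ(X(t,y)) dμ = ∫ ψ dμ` for all `t` and all continuous
`ℤ^d`-periodic `ψ`. -/
def FlowInvariant {d : ℕ} (X : ℝ → (Fin d → ℝ) → (Fin d → ℝ))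
    (μ : Measure (Fin d → ℝ)) : Prop :=
  ∀ (t : ℝ) (ψ : (Fin d → ℝ) → ℝ), Continuous ψ → ZdPeriodic ψ →
    ∫ y, ψ (X t y) ∂μ = ∫ y, ψ y ∂μ

/-- Herman's rotation set `C_b = {∫ b dμ : μ invariant probability measure for the flow}`. -/
def rotationSet {d : ℕ} (b : (Fin d → ℝ) → (Fin d → ℝ))
    (X : ℝ → (Fin d → ℝ) → (Fin d → ℝ)) : Set (Fin d → ℝ) :=
  {ζ | ∃ μ : Measure (Fin d → ℝ), IsProbabilityMeasure μ ∧ μ (unitCube d)ᶜ = 0 ∧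
        FlowInvariant X μ ∧ ζ = ∫ y, b y ∂μ}

/-- The gradient of a scalar function on `ℝ^d`. -/
def grad {d : ℕ} (ψ : (Fin d → ℝ) → ℝ) (y : Fin d → ℝ) : Fin d → ℝ :=
  fun i => fderiv ℝ ψ y (Pi.single i 1)

/-- The rotation `R⊥` by `−π/2` in `ℝ²`: `R⊥(v₁,v₂) = (v₂,−v₁)`. -/
def Rperp (v : Fin 2 → ℝ) : Fin 2 → ℝ := ![v 1, -(v 0)]

/-- A continuous periodic function is bounded. -/
theorem ZdPeriodic.bounded {d : ℕ} {G : Type*} [SeminormedAddCommGroup G]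
    {f : (Fin d → ℝ) → G} (hp : ZdPeriodic f) (hf : Continuous f) : ∃ C, ∀ x, ‖f x‖ ≤ C := by
  have hK : IsCompact (Set.Icc (0 : Fin d → ℝ) 1) := isCompact_Icc
  obtain ⟨C, hC⟩ := hK.exists_bound_of_continuousOn hf.continuousOn
  refine ⟨C, fun x => ?_⟩
  have h := hp (fun i => -⌊x i⌋) x
  rw [← h]
  apply hC
  constructor
  · intro i; simpa using Int.floor_le (x i)
  · intro i
    have := (Int.lt_floor_add_one (x i)).le
    simp; linarith

/-- A `C¹` periodic function is globally Lipschitz. -/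
theorem ZdPeriodic.lipschitz {d : ℕ} {G : Type*} [NormedAddCommGroup G] [NormedSpace ℝ G]
    {f : (Fin d → ℝ) → G} (hp : ZdPeriodic f) (hf : ContDiff ℝ 1 f) :
    ∃ K, LipschitzWith K f := by
  have h1 : ZdPeriodic (fderiv ℝ f) := by
    intro κ x
    have : (fun y => f (y + fun i => (κ i : ℝ))) = f := funext (hp κ)
    rw [← fderiv_comp_add_right, this]
  obtain ⟨C, hC⟩ := h1.bounded (hf.continuous_fderiv (by norm_num))
  exact ⟨C.toNNReal, lipschitzWith_of_nnnorm_fderiv_le (hf.differentiable (by norm_num)) fun x =>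
    by
      rw [← NNReal.coe_le_coe]
      exact (hC x).trans (Real.le_coe_toNNReal C)⟩

section Flow

variable {d : ℕ} {F : (Fin d → ℝ) → (Fin d → ℝ)} {Y : ℝ → (Fin d → ℝ) → (Fin d → ℝ)}
  {K : NNReal}

/-- A bounded globally Lipschitz vector field has a global flow. -/
theorem exists_isFlowOf (hF : LipschitzWith K F) {C : ℝ} (hC : ∀ x, ‖F x‖ ≤ C) :
    ∃ Y, IsFlowOf F Y := by
  have hC0 : 0 ≤ C := (norm_nonneg _).trans (hC 0)
  have key : ∀ (x : Fin d → ℝ) (n : ℕ), ∃ α : ℝ → (Fin d → ℝ), α 0 = x ∧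
      ∀ t ∈ Set.Ioo (-((n : ℝ) + 1)) ((n : ℝ) + 1), HasDerivAt α (F (α t)) t := by
    intro x n
    have h0 : (0 : ℝ) ∈ Set.Icc (-((n : ℝ) + 1)) ((n : ℝ) + 1) := by
      constructor <;> linarith [(Nat.cast_nonneg n : (0 : ℝ) ≤ n)]
    have hpl : IsPicardLindelof (fun _ => F) (⟨0, h0⟩ : Set.Icc (-((n : ℝ) + 1)) ((n : ℝ) + 1)) x
        (C * (n + 1)).toNNReal 0 C.toNNReal K := by
      refine ⟨fun t _ => hF.lipschitzOnWith, fun x _ => continuousOn_const, fun t _ x _ => ?_, ?_⟩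
      · exact (hC x).trans (Real.le_coe_toNNReal C)
      · rw [Real.coe_toNNReal C hC0, Real.coe_toNNReal _ (by positivity)]
        simp
    obtain ⟨α, h1, h2⟩ := hpl.exists_eq_forall_mem_Icc_hasDerivWithinAt₀
    exact ⟨α, h1, fun t ht => (h2 t (Set.Ioo_subset_Icc_self ht)).hasDerivAt
      (Icc_mem_nhds ht.1 ht.2)⟩
  choose α h1 h2 using key
  have hagree : ∀ x (n m : ℕ), n ≤ m →
      Set.EqOn (α x n) (α x m) (Set.Ioo (-((n : ℝ) + 1)) ((n : ℝ) + 1)) := by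
    intro x n m hnm
    have hnm' : (n : ℝ) ≤ m := by exact_mod_cast hnm
    refine ODE_solution_unique_of_mem_Ioo (v := fun _ => F) (s := fun _ => Set.univ) (t₀ := 0)
      (K := K) (fun t _ => hF.lipschitzOnWith) ?_ (fun t ht => ⟨h2 x n t ht, trivial⟩)
      (fun t ht => ⟨h2 x m t ⟨by linarith [ht.1], by linarith [ht.2]⟩, trivial⟩)
      (by rw [h1, h1])
    constructor <;> linarith [(Nat.cast_nonneg n : (0 : ℝ) ≤ n)]
  refine ⟨fun t x => α x ⌈|t|⌉₊ t, fun x => ⟨by simp [h1], fun t => ?_⟩⟩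
  have hmem : ∀ s : ℝ, s ∈ Set.Ioo (-((⌈|s|⌉₊ : ℝ) + 1)) ((⌈|s|⌉₊ : ℝ) + 1) := by
    intro s
    have := Nat.le_ceil |s|
    constructor <;> linarith [neg_abs_le s, le_abs_self s]
  refine (h2 x _ t (hmem t)).congr_of_eventuallyEq ?_
  filter_upwards [isOpen_Ioo.mem_nhds (hmem t)] with s hs
  rcases le_total ⌈|s|⌉₊ ⌈|t|⌉₊ with h | h
  · exact hagree x _ _ h (hmem s)
  · exact (hagree x _ _ h hs).symm

namespace IsFlowOf

theorem eq_of_hasDerivAt (hY : IsFlowOf F Y) (hF : LipschitzWith K F) {γ : ℝ → (Fin d → ℝ)}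
    (hγ : ∀ t, HasDerivAt γ (F (γ t)) t) (t : ℝ) : γ t = Y t (γ 0) := by
  have := ODE_solution_unique_univ (v := fun _ => F) (s := fun _ => Set.univ) (t₀ := 0)
      (K := K) (f := γ) (g := fun t => Y t (γ 0)) (fun t => hF.lipschitzOnWith)
      (fun t => ⟨hγ t, trivial⟩) (fun t => ⟨(hY _).2 t, trivial⟩) (by simp [(hY _).1])
  exact congrFun this t

theorem add_apply (hY : IsFlowOf F Y) (hF : LipschitzWith K F) (s t : ℝ) (x : Fin d → ℝ) :
    Y (s + t) x = Y s (Y t x) := by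
  have h := hY.eq_of_hasDerivAt hF (γ := fun s => Y (s + t) x)
    (fun s => ((hY x).2 (s + t)).comp_add_const s t) s
  simpa using h

theorem neg_apply (hY : IsFlowOf F Y) (hF : LipschitzWith K F) (t : ℝ) (x : Fin d → ℝ) :
    Y (-t) (Y t x) = x := by
  rw [← hY.add_apply hF, neg_add_cancel, (hY x).1]

theorem apply_neg (hY : IsFlowOf F Y) (hF : LipschitzWith K F) (t : ℝ) (x : Fin d → ℝ) :
    Y t (Y (-t) x) = x := by
  rw [← hY.add_apply hF, add_neg_cancel, (hY x).1]

theorem neg (hY : IsFlowOf F Y) : IsFlowOf (fun x => - F x) (fun t => Y (-t)) := by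
  refine fun x => ⟨by simp [(hY x).1], fun t => ?_⟩
  have := ((hY x).2 (-t)).scomp t (hasDerivAt_neg t)
  rw [neg_one_smul] at this
  exact this

theorem equivariant (hY : IsFlowOf F Y) (hF : LipschitzWith K F) (hp : ZdPeriodic F)
    (κ : Fin d → ℤ) (t : ℝ) (x : Fin d → ℝ) :
    Y t (x + fun i => (κ i : ℝ)) = Y t x + fun i => (κ i : ℝ) := by
  have h := hY.eq_of_hasDerivAt hF (γ := fun s => Y s x + fun i => (κ i : ℝ))
    (fun s => by rw [hp]; exact ((hY x).2 s).add_const _) t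
  simpa [(hY x).1] using h.symm

theorem lipschitz (hY : IsFlowOf F Y) (hF : LipschitzWith K F) (t : ℝ) :
    LipschitzWith (Real.exp (K * |t|)).toNNReal (Y t) := by
  have main : ∀ {F : (Fin d → ℝ) → (Fin d → ℝ)} {Y : ℝ → (Fin d → ℝ) → (Fin d → ℝ)},
      IsFlowOf F Y → LipschitzWith K F → ∀ t, 0 ≤ t → ∀ x y,
      dist (Y t x) (Y t y) ≤ Real.exp (K * |t|) * dist x y := by
    intro F Y hY hF t ht x y
    have := dist_le_of_trajectories_ODE (v := fun _ => F) (K := K) (a := 0) (b := t)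
      (f := fun s => Y s x) (g := fun s => Y s y) (δ := dist x y) (fun _ => hF)
      (fun s _ => ((hY x).2 s).continuousAt.continuousWithinAt)
      (fun s _ => ((hY x).2 s).hasDerivWithinAt)
      (fun s _ => ((hY y).2 s).continuousAt.continuousWithinAt)
      (fun s _ => ((hY y).2 s).hasDerivWithinAt) (by simp [(hY _).1]) t ⟨ht, le_rfl⟩
    rw [abs_of_nonneg ht, mul_comm]
    simpa using this
  refine LipschitzWith.of_dist_le_mul fun x y => ?_
  rw [Real.coe_toNNReal _ (Real.exp_pos _).le]
  rcases le_total 0 t with ht | ht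
  · exact main hY hF t ht x y
  · have := main hY.neg (LipschitzWith.of_dist_le_mul fun x y => by
      simpa using hF.dist_le_mul x y) (-t) (by linarith) x y
    simpa using this

theorem dist_le (hY : IsFlowOf F Y) {C : ℝ} (hC : ∀ x, ‖F x‖ ≤ C) (s t : ℝ) (x : Fin d → ℝ) :
    ‖Y t x - Y s x‖ ≤ C * |t - s| := by
  have := convex_univ.norm_image_sub_le_of_norm_hasDerivWithin_le (f := fun t => Y t x)
    (f' := fun t => F (Y t x)) (s := Set.univ) (C := C) (x := s) (y := t)
    (fun t _ => ((hY x).2 t).hasDerivWithinAt) (fun t _ => hC _) trivial trivial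
  simpa using this

theorem norm_sub_le (hY : IsFlowOf F Y) {C : ℝ} (hC : ∀ x, ‖F x‖ ≤ C) (t : ℝ) (x : Fin d → ℝ) :
    ‖Y t x - x‖ ≤ C * |t| := by
  simpa [(hY x).1] using hY.dist_le hC 0 t x

theorem continuous_time (hY : IsFlowOf F Y) (x : Fin d → ℝ) : Continuous fun t => Y t x :=
  continuous_iff_continuousAt.2 fun t => ((hY x).2 t).continuousAt

theorem continuous_space (hY : IsFlowOf F Y) (hF : LipschitzWith K F) (t : ℝ) : Continuous (Y t) :=
  (hY.lipschitz hF t).continuous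

theorem continuous_uncurry (hY : IsFlowOf F Y) (hF : LipschitzWith K F) {C : ℝ}
    (hC : ∀ x, ‖F x‖ ≤ C) : Continuous fun p : ℝ × (Fin d → ℝ) => Y p.1 p.2 := by
  have hC0 : 0 ≤ C := (norm_nonneg _).trans (hC 0)
  refine (continuous_prod_of_continuous_lipschitzWith (fun p : ℝ × (Fin d → ℝ) => Y p.1 p.2)
    C.toNNReal (fun t => hY.continuous_space hF t) fun x => ?_)
  refine LipschitzWith.of_dist_le_mul fun s t => ?_
  rw [Real.coe_toNNReal _ hC0, dist_eq_norm, Real.dist_eq]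
  exact hY.dist_le hC t s x

/-- The time-`t` map of a flow, as a homeomorphism. -/
def homeomorph (hY : IsFlowOf F Y) (hF : LipschitzWith K F) (t : ℝ) :
    (Fin d → ℝ) ≃ₜ (Fin d → ℝ) where
  toFun := Y t
  invFun := Y (-t)
  left_inv := hY.neg_apply hF t
  right_inv := hY.apply_neg hF t
  continuous_toFun := hY.continuous_space hF t
  continuous_invFun := hY.continuous_space hF (-t)

end IsFlowOf

end Flow

theorem MeasureTheory.Measure.measure_le_of_integral_lipschitz_eq {X : Type*} [PseudoEMetricSpace X]
    [MeasurableSpace X] [BorelSpace X] [LocallyCompactSpace X]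
    {μ ν : Measure X} [IsLocallyFiniteMeasure μ] [IsLocallyFiniteMeasure ν]
    (h : ∀ (f : X → ℝ) (L : NNReal), LipschitzWith L f → HasCompactSupport f →
      ∫ x, f x ∂μ = ∫ x, f x ∂ν) {K : Set X} (hK : IsCompact K) (hK' : IsClosed K) :
    μ K ≤ ν K := by
  obtain ⟨K', hK'c, hKK'⟩ := exists_compact_superset hK
  obtain ⟨δ, hδ, hδK⟩ := hK.exists_thickening_subset_open isOpen_interior hKK'
  have hδK' : Metric.thickening δ K ⊆ K' := hδK.trans interior_subset
  have hfin : ν (Metric.thickening δ K) ≠ ⊤ :=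
    ((measure_mono hδK').trans_lt hK'c.measure_lt_top).ne
  have hlim := tendsto_measure_thickening_of_isClosed ⟨δ, hδ, hfin⟩ hK'
  refine ge_of_tendsto hlim ?_
  have hev : Set.Ioo (0 : ℝ) δ ∈ nhdsWithin (0 : ℝ) (Set.Ioi 0) := Ioo_mem_nhdsGT hδ
  filter_upwards [hev] with ε hε
  have hεK : Metric.cthickening ε K ⊆ Metric.thickening δ K :=
    Metric.cthickening_subset_thickening' hδ hε.2 K
  set f : X → ℝ := fun x => (thickenedIndicator hε.1 K x : ℝ) with hf
  have hLip : LipschitzWith ε.toNNReal⁻¹ f := by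
    have := lipschitzWith_thickenedIndicator hε.1 K
    exact fun x y => this x y
  have hsupp : ∀ x, x ∉ Metric.thickening ε K → f x = 0 := fun x hx => by
    simp only [hf]
    rw [thickenedIndicator_zero hε.1 K hx, NNReal.coe_zero]
  have hcs : HasCompactSupport f := by
    refine HasCompactSupport.intro' (K := K' ∩ Metric.cthickening ε K)
      (hK'c.inter_right Metric.isClosed_cthickening)
      ?_ fun x hx => hsupp x fun hx' => hx ⟨hδK' (hεK (Metric.thickening_subset_cthickening _ _ hx')),
        Metric.thickening_subset_cthickening _ _ hx'⟩
    have : K' ∩ Metric.cthickening ε K = Metric.cthickening ε K :=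
      Set.inter_eq_right.2 (hεK.trans hδK')
    rw [this]
    exact Metric.isClosed_cthickening
  have hcont := hLip.continuous
  have hInt : ∀ (m : Measure X) [IsLocallyFiniteMeasure m],
      ∫⁻ x, ENNReal.ofReal (f x) ∂m = ENNReal.ofReal (∫ x, f x ∂m) := fun m _ =>
    (ofReal_integral_eq_lintegral_ofReal (hcont.integrable_of_hasCompactSupport hcs)
      (ae_of_all _ fun x => by positivity)).symm
  calc μ K = ∫⁻ x, K.indicator 1 x ∂μ := by rw [lintegral_indicator_one hK'.measurableSet]
    _ ≤ ∫⁻ x, ENNReal.ofReal (f x) ∂μ := by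
        refine lintegral_mono fun x => ?_
        by_cases hx : x ∈ K
        · rw [Set.indicator_of_mem hx]
          simp only [hf]
          rw [thickenedIndicator_one hε.1 K hx]
          simp
        · simp [hx]
    _ = ∫⁻ x, ENNReal.ofReal (f x) ∂ν := by rw [hInt, hInt, h f _ hLip hcs]
    _ ≤ ∫⁻ x, (Metric.thickening ε K).indicator 1 x ∂ν := by
        refine lintegral_mono fun x => ?_
        by_cases hx : x ∈ Metric.thickening ε K
        · rw [Set.indicator_of_mem hx, Pi.one_apply, ENNReal.ofReal_le_one]
          exact_mod_cast thickenedIndicator_le_one hε.1 K x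
        · simp [hx, hsupp x hx]
    _ = ν (Metric.thickening ε K) := by
        rw [lintegral_indicator_one Metric.isOpen_thickening.measurableSet]

/-- Locally finite measures on `ℝ^d` are determined by integrals of compactly supported Lipschitz
functions. -/
theorem MeasureTheory.Measure.ext_of_integral_lipschitz_eq {d : ℕ}
    {μ ν : Measure (Fin d → ℝ)} [IsLocallyFiniteMeasure μ] [IsLocallyFiniteMeasure ν]
    (h : ∀ (f : (Fin d → ℝ) → ℝ) (L : NNReal), LipschitzWith L f → HasCompactSupport f →
      ∫ x, f x ∂μ = ∫ x, f x ∂ν) : μ = ν := by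
  apply Measure.OuterRegular.ext_isOpen
  apply Measure.InnerRegularWRT.eq_of_innerRegularWRT_of_forall_eq Measure.Regular.innerRegular
    Measure.Regular.innerRegular
  intro K hK
  exact le_antisymm (measure_le_of_integral_lipschitz_eq h hK hK.isClosed)
    (measure_le_of_integral_lipschitz_eq (fun f L h1 h2 => (h f L h1 h2).symm) hK hK.isClosed)

theorem clm_apply_eq_sum {d : ℕ} (A : (Fin d → ℝ) →L[ℝ] ℝ) (y : Fin d → ℝ) :
    A y = ∑ i, y i * A (Pi.single i 1) := by
  conv_lhs => rw [pi_eq_sum_univ' y]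
  simp [map_sum]

/-- The integral of the derivative of a compactly supported Lipschitz function along a
divergence-free vector field vanishes. -/
theorem integral_fderiv_apply_eq_zero {d : ℕ} {v : (Fin d → ℝ) → (Fin d → ℝ)} {Kv : NNReal}
    (hv : ContDiff ℝ 1 v) (hvL : LipschitzWith Kv v)
    (hdiv : ∀ x, ∑ i, fderiv ℝ v x (Pi.single i 1) i = 0)
    {η : (Fin d → ℝ) → ℝ} {L : NNReal} (hη : LipschitzWith L η) (hc : HasCompactSupport η) :
    ∫ y, fderiv ℝ η y (v y) = 0 := by
  have hvi : ∀ i, LipschitzWith Kv fun y => v y i := fun i => by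
    simpa using! (LipschitzWith.eval i).comp hvL
  have hvd : ∀ i x, HasFDerivAt (fun y => v y i)
      ((ContinuousLinearMap.proj i).comp (fderiv ℝ v x)) x := fun i x =>
    (ContinuousLinearMap.proj (R := ℝ) (φ := fun _ : Fin d => ℝ) i).hasFDerivAt.comp x
      (hv.differentiable (by norm_num) x).hasFDerivAt
  have hInt : ∀ i, Integrable (fun y => v y i * fderiv ℝ η y (Pi.single i 1)) := by
    intro i
    have hmeas : Measurable fun y => v y i * fderiv ℝ η y (Pi.single i 1) :=
      (hvi i).continuous.measurable.mul (measurable_fderiv_apply_const ℝ η _)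
    obtain ⟨C, hC⟩ := hc.isCompact.exists_bound_of_continuousOn (hvi i).continuous.continuousOn
    have hsub : Function.support (fun y => v y i * fderiv ℝ η y (Pi.single i 1)) ⊆ tsupport η := by
      intro y hy
      have : fderiv ℝ η y ≠ 0 := by
        rintro h0
        simp [h0] at hy
      exact support_fderiv_subset ℝ this
    rw [← integrableOn_iff_integrable_of_support_subset hsub]
    refine Measure.integrableOn_of_bounded (M := C * (L * ‖(Pi.single i 1 : Fin d → ℝ)‖))
      hc.isCompact.measure_lt_top.ne
      hmeas.aestronglyMeasurable ?_
    refine (ae_restrict_iff' (isClosed_tsupport η).measurableSet).2 (ae_of_all _ fun y hy => ?_)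
    rw [norm_mul]
    refine mul_le_mul (hC y hy) ?_ (norm_nonneg _) ((norm_nonneg _).trans (hC y hy))
    exact (ContinuousLinearMap.le_opNorm _ _).trans
      (mul_le_mul_of_nonneg_right (norm_fderiv_le_of_lipschitz ℝ hη) (norm_nonneg _))
  have hpart : ∀ i, ∫ y, v y i * fderiv ℝ η y (Pi.single i 1) =
      ∫ y, - (fderiv ℝ v y (Pi.single i 1) i * η y) := by
    intro i
    have h1 := LipschitzWith.integral_lineDeriv_mul_eq (μ := volume) (hvi i) hη hc (-Pi.single i 1)
    rw [neg_neg] at h1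
    have h2 : ∫ y, v y i * fderiv ℝ η y (Pi.single i 1) =
        ∫ x, lineDeriv ℝ η x (Pi.single i 1) * v x i := by
      refine integral_congr_ae ?_
      filter_upwards [hη.ae_differentiableAt (μ := volume)] with y hy
      rw [hy.lineDeriv_eq_fderiv, mul_comm]
    rw [h2, ← h1]
    refine integral_congr_ae (ae_of_all _ fun y => ?_)
    simp only
    rw [(hvd i y).differentiableAt.lineDeriv_eq_fderiv, (hvd i y).fderiv]
    simp
  have hsum : ∀ y, fderiv ℝ η y (v y) = ∑ i, v y i * fderiv ℝ η y (Pi.single i 1) := fun y =>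
    clm_apply_eq_sum _ _
  simp_rw [hsum]
  rw [integral_finsetSum _ fun i _ => hInt i]
  simp_rw [hpart]
  rw [← integral_finsetSum]
  · simp_rw [Finset.sum_neg_distrib, ← Finset.sum_mul, hdiv]
    simp
  · intro i _
    have hcd : Continuous fun y => fderiv ℝ v y (Pi.single i 1) i :=
      (continuous_apply i).comp ((hv.continuous_fderiv (by norm_num)).clm_apply continuous_const)
    exact ((hcd.mul hη.continuous).integrable_of_hasCompactSupport hc.mul_left).neg

theorem IsFlowOf.hasCompactSupport_comp {d : ℕ} {F : (Fin d → ℝ) → (Fin d → ℝ)}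
    {Y : ℝ → (Fin d → ℝ) → (Fin d → ℝ)} {C : ℝ} (hY : IsFlowOf F Y) (hC : ∀ x, ‖F x‖ ≤ C)
    {G : Type*} [Zero G] {ψ : (Fin d → ℝ) → G} (hψ : HasCompactSupport ψ) (T : ℝ) :
    IsCompact (Metric.cthickening (C * T) (tsupport ψ)) ∧
    ∀ t, |t| ≤ T → ∀ y, y ∉ Metric.cthickening (C * T) (tsupport ψ) → ψ (Y t y) = 0 := by
  have hC0 : 0 ≤ C := (norm_nonneg _).trans (hC 0)
  refine ⟨hψ.isCompact.cthickening, fun t ht y hy => ?_⟩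
  by_contra h
  refine hy (Metric.mem_cthickening_of_dist_le y (Y t y) _ _ (subset_tsupport _ h) ?_)
  rw [dist_comm, dist_eq_norm]
  exact (hY.norm_sub_le hC t y).trans (mul_le_mul_of_nonneg_left ht hC0)

theorem IsFlowOf.isLocallyFiniteMeasure_map {d : ℕ} {F : (Fin d → ℝ) → (Fin d → ℝ)}
    {Y : ℝ → (Fin d → ℝ) → (Fin d → ℝ)} {K : NNReal} (hY : IsFlowOf F Y)
    (hF : LipschitzWith K F) (M : Measure (Fin d → ℝ)) [IsLocallyFiniteMeasure M] (t : ℝ) :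
    IsLocallyFiniteMeasure (M.map (Y t)) := by
  refine ⟨fun x => ?_⟩
  obtain ⟨K', hK', hx⟩ := exists_compact_mem_nhds x
  refine ⟨K', hx, ?_⟩
  rw [Measure.map_apply (hY.continuous_space hF t).measurable hK'.isClosed.measurableSet]
  exact ((hY.homeomorph hF t).isCompact_preimage.2 hK').measure_lt_top

/-- **Liouville's theorem**: if `v` is divergence free, the flow of `g v` preserves the measure
with density `1/g`, provided this measure is locally finite. -/
theorem IsFlowOf.map_withDensity_inv {d : ℕ} {v : (Fin d → ℝ) → (Fin d → ℝ)} {Kv : NNReal}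
    (hv : ContDiff ℝ 1 v) (hvL : LipschitzWith Kv v)
    (hdiv : ∀ x, ∑ i, fderiv ℝ v x (Pi.single i 1) i = 0)
    {g : (Fin d → ℝ) → ℝ} (hg : Continuous g) (hg0 : ∀ x, 0 ≤ g x)
    {Y : ℝ → (Fin d → ℝ) → (Fin d → ℝ)} (hY : IsFlowOf (fun y => g y • v y) Y)
    {K : NNReal} (hF : LipschitzWith K fun y => g y • v y) {C : ℝ} (hC : ∀ x, ‖g x • v x‖ ≤ C)
    [IsLocallyFiniteMeasure
      ((volume : Measure (Fin d → ℝ)).withDensity fun y => (ENNReal.ofReal (g y))⁻¹)] (t : ℝ) :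
    ((volume : Measure (Fin d → ℝ)).withDensity fun y => (ENNReal.ofReal (g y))⁻¹).map (Y t) =
      (volume : Measure (Fin d → ℝ)).withDensity fun y => (ENNReal.ofReal (g y))⁻¹ := by
  set w : (Fin d → ℝ) → ENNReal := fun y => (ENNReal.ofReal (g y))⁻¹ with hw
  set M := (volume : Measure (Fin d → ℝ)).withDensity w with hM
  have hC0 : 0 ≤ C := (norm_nonneg _).trans (hC 0)
  have hwm : Measurable w := hg.measurable.ennreal_ofReal.inv
  have hMac : M ≪ volume := withDensity_absolutelyContinuous _ _
  have hwfin : ∀ᵐ y, w y < ⊤ := by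
    have hball : ∀ n : ℕ, ∀ᵐ y, y ∈ Metric.closedBall (0 : Fin d → ℝ) n → w y < ⊤ := fun n => by
      rw [← ae_restrict_iff' Metric.isClosed_closedBall.measurableSet]
      refine ae_lt_top hwm ?_
      rw [← withDensity_apply _ Metric.isClosed_closedBall.measurableSet]
      exact (isCompact_closedBall _ _).measure_lt_top.ne
    filter_upwards [ae_all_iff.2 hball] with y hy
    obtain ⟨n, hn⟩ := exists_nat_ge ‖y‖
    exact hy n (by simpa using hn)
  have hloc := hY.isLocallyFiniteMeasure_map hF M t
  refine Measure.ext_of_integral_lipschitz_eq fun ψ L hψ hψc => ?_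
  rw [integral_map (hY.continuous_space hF t).aemeasurable hψ.continuous.aestronglyMeasurable]
  have hder : ∀ t₀, HasDerivAt (fun t => ∫ y, ψ (Y t y) ∂M) 0 t₀ := by
    intro t₀
    set η : (Fin d → ℝ) → ℝ := fun y => ψ (Y t₀ y) with hη
    have hηL := hψ.comp (hY.lipschitz hF t₀)
    obtain ⟨hKc, hK0⟩ := hY.hasCompactSupport_comp hC hψc (|t₀| + 1)
    set K' := Metric.cthickening (C * (|t₀| + 1)) (tsupport ψ)
    have hηc : HasCompactSupport η :=
      HasCompactSupport.intro hKc fun y hy => hK0 t₀ (by linarith) y hy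
    have hηd : ∀ᵐ y ∂M, DifferentiableAt ℝ η y := hMac.ae_le hηL.ae_differentiableAt
    have hcont : ∀ s, Continuous fun y => ψ (Y s y) := fun s =>
      hψ.continuous.comp (hY.continuous_space hF s)
    have hzero : ∫ y, fderiv ℝ η y (g y • v y) ∂M = 0 := by
      rw [hM, integral_withDensity_eq_integral_toReal_smul hwm hwfin,
        ← integral_fderiv_apply_eq_zero hv hvL hdiv hηL hηc]
      refine integral_congr_ae ?_
      filter_upwards [hwfin] with y hy
      have hgy : 0 < g y := by
        by_contra h
        simp [hw, ENNReal.ofReal_eq_zero.2 (not_lt.1 h)] at hy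
      rw [map_smul, smul_smul, hw]
      simp only [ENNReal.toReal_inv, ENNReal.toReal_ofReal (hg0 y)]
      rw [inv_mul_cancel₀ hgy.ne', one_smul]
      rfl
    rw [← hzero]
    refine (hasDerivAt_integral_of_dominated_loc_of_lip (s := Metric.ball t₀ 1)
      (bound := K'.indicator fun _ => L * C) (Metric.ball_mem_nhds t₀ one_pos)
      (Eventually.of_forall fun s => (hcont s).aestronglyMeasurable)
      ((hcont t₀).integrable_of_hasCompactSupport hηc) ?_ ?_ ?_ ?_).2
    · rw [funext fun y => clm_apply_eq_sum (fderiv ℝ η y) (g y • v y)]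
      refine (Finset.measurable_fun_sum _ fun i _ => ?_).aestronglyMeasurable
      refine Measurable.mul ?_ (measurable_fderiv_apply_const ℝ η _)
      exact ((continuous_apply i).comp hF.continuous).measurable
    · refine ae_of_all _ fun y => ?_
      refine LipschitzOnWith.of_dist_le_mul fun s hs s' hs' => ?_
      by_cases hy : y ∈ K'
      · rw [Set.indicator_of_mem hy, Real.coe_nnabs, abs_of_nonneg (mul_nonneg L.coe_nonneg hC0), mul_assoc]
        refine (hψ.dist_le_mul _ _).trans (mul_le_mul_of_nonneg_left ?_ L.2)
        rw [dist_eq_norm]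
        exact hY.dist_le hC s' s y
      · have hle : ∀ s ∈ Metric.ball t₀ 1, |s| ≤ |t₀| + 1 := fun s hs => by
          rw [Metric.mem_ball, Real.dist_eq] at hs
          have := abs_sub_abs_le_abs_sub s t₀
          linarith
        rw [hK0 s (hle s hs) y hy, hK0 s' (hle s' hs') y hy]
        simp [hy]
    · exact (integrable_indicator_iff Metric.isClosed_cthickening.measurableSet).2
        (integrableOn_const hKc.measure_lt_top.ne)
    · filter_upwards [hηd] with y hy
      have h1 : HasDerivAt (fun s => η (Y s y)) (fderiv ℝ η y (g y • v y)) 0 := by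
        have h2 := (hY y).2 0
        rw [(hY y).1] at h2
        have hy' : HasFDerivAt η (fderiv ℝ η y) (Y 0 y) := by
          rw [(hY y).1]; exact hy.hasFDerivAt
        exact HasFDerivAt.comp_hasDerivAt (l := η) (f := fun s => Y s y) 0 hy' h2
      have h3 : (fun s => ψ (Y s y)) = fun s => η (Y (s - t₀) y) := by
        funext s
        rw [hη]
        simp only
        rw [← hY.add_apply hF]
        congr 2
        ring
      rw [h3]
      have := HasDerivAt.comp_sub_const (x := t₀) (a := t₀) (f := fun s => η (Y s y))
        (f' := fderiv ℝ η y (g y • v y)) (by simpa using h1)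
      exact this
  have hconst := is_const_of_deriv_eq_zero (fun s => (hder s).differentiableAt)
    (fun s => (hder s).deriv) t 0
  rw [hconst]
  simp [(hY _).1]

/-- The inclusion `ℤ^d → ℝ^d`. -/
def intVec (d : ℕ) : (Fin d → ℤ) →+ (Fin d → ℝ) where
  toFun κ := fun i => (κ i : ℝ)
  map_zero' := by ext; simp
  map_add' κ κ' := by ext; simp

@[simp]
theorem intVec_apply {d : ℕ} (κ : Fin d → ℤ) (i : Fin d) : intVec d κ i = κ i := rfl

theorem ZdPeriodic.add_intVec {d : ℕ} {E : Type*} {f : (Fin d → ℝ) → E} (hf : ZdPeriodic f)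
    (κ : Fin d → ℤ) (x : Fin d → ℝ) : f (x + intVec d κ) = f x := hf κ x

theorem measurableSet_unitCube (d : ℕ) : MeasurableSet (unitCube d) := by
  have : unitCube d = Set.pi Set.univ fun _ => Set.Ico (0 : ℝ) 1 := by
    ext; simp [unitCube]
  rw [this]
  exact MeasurableSet.univ_pi fun _ => measurableSet_Ico

theorem volume_unitCube (d : ℕ) : volume (unitCube d) = 1 := by
  have : unitCube d = Set.pi Set.univ fun _ => Set.Ico (0 : ℝ) 1 := by
    ext
    simp [unitCube]
  rw [this, volume_pi_pi]
  simp

theorem norm_le_of_mem_unitCube {d : ℕ} {x : Fin d → ℝ} (hx : x ∈ unitCube d) : ‖x‖ ≤ 1 := by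
  rw [pi_norm_le_iff_of_nonneg zero_le_one]
  intro i
  rw [Real.norm_eq_abs, abs_of_nonneg (hx i).1]
  exact (hx i).2.le

/-- The representative of `x` modulo `ℤ^d` in the unit cube. -/
def fractVec {d : ℕ} (x : Fin d → ℝ) : Fin d → ℝ := fun i => Int.fract (x i)

theorem fractVec_mem {d : ℕ} (x : Fin d → ℝ) : fractVec x ∈ unitCube d := fun _ =>
  ⟨Int.fract_nonneg _, Int.fract_lt_one _⟩

theorem fractVec_add_intVec {d : ℕ} (x : Fin d → ℝ) :
    fractVec x + intVec d (fun i => ⌊x i⌋) = x := by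
  ext i
  simp [fractVec, Int.fract_add_floor]

theorem ZdPeriodic.apply_fractVec {d : ℕ} {E : Type*} {f : (Fin d → ℝ) → E} (hf : ZdPeriodic f)
    (x : Fin d → ℝ) : f (fractVec x) = f x := by
  conv_rhs => rw [← fractVec_add_intVec x, hf.add_intVec]

theorem eq_zero_of_mem_unitCube {d : ℕ} {x : Fin d → ℝ} {κ : Fin d → ℤ} (hx : x ∈ unitCube d)
    (hκ : x + intVec d κ ∈ unitCube d) : κ = 0 := by
  ext i
  have h1 := hx i
  have h2 := hκ i
  simp only [Pi.add_apply, intVec_apply, Set.mem_Ico] at h1 h2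
  have h3 : (κ i : ℝ) < 1 := by linarith
  have h4 : (-1 : ℝ) < κ i := by linarith
  have h5 : κ i < 1 := by exact_mod_cast h3
  have h6 : -1 < κ i := by exact_mod_cast h4
  simp only [Pi.zero_apply]
  omega

theorem finite_norm_intVec_le (d : ℕ) (R : ℝ) : {κ : Fin d → ℤ | ‖intVec d κ‖ ≤ R}.Finite := by
  refine (Set.finite_Icc (fun _ : Fin d => -⌈R⌉) fun _ => ⌈R⌉).subset fun κ hκ => ?_
  have h : ∀ i, |(κ i : ℝ)| ≤ ⌈R⌉ := fun i =>
    ((norm_le_pi_norm (intVec d κ) i).trans hκ).trans (Int.le_ceil R)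
  constructor
  · intro i
    have := (abs_le.1 (h i)).1
    exact_mod_cast this
  · intro i
    have := (abs_le.1 (h i)).2
    exact_mod_cast this

/-- A measure is `ℤ^d`-invariant if it is invariant under integer translations. -/
def IntInvariant {d : ℕ} (M : Measure (Fin d → ℝ)) : Prop :=
  ∀ κ : Fin d → ℤ, MeasurePreserving (fun x => x + intVec d κ) M M

theorem intInvariant_volume (d : ℕ) : IntInvariant (volume : Measure (Fin d → ℝ)) := fun _ =>
  measurePreserving_add_right volume _

theorem IntInvariant.withDensity {d : ℕ} {M : Measure (Fin d → ℝ)} (hM : IntInvariant M)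
    {f : (Fin d → ℝ) → ENNReal} (hf : ZdPeriodic f) (hfm : Measurable f) :
    IntInvariant (M.withDensity f) := fun κ => by
  refine ⟨(measurable_id.add_const _), Measure.ext fun A hA => ?_⟩
  have hm : Measurable fun x : Fin d → ℝ => x + intVec d κ := measurable_id.add_const _
  rw [Measure.map_apply hm hA, withDensity_apply _ hA, withDensity_apply _ (hm hA)]
  conv_rhs => rw [← (hM κ).setLIntegral_comp_preimage hA hfm]
  simp_rw [hf.add_intVec]

section FundamentalDomain

variable {d : ℕ} {M : Measure (Fin d → ℝ)}

theorem isAddFundamentalDomain_unitCube (M : Measure (Fin d → ℝ)) :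
    IsAddFundamentalDomain (intVec d).range (unitCube d) M := by
  refine IsAddFundamentalDomain.mk' (measurableSet_unitCube d).nullMeasurableSet fun x => ?_
  refine ⟨⟨intVec d (fun i => -⌊x i⌋), ⟨_, rfl⟩⟩, ?_, ?_⟩
  · have : fractVec x = intVec d (fun i => -⌊x i⌋) + x := by
      ext i
      rw [Pi.add_apply, intVec_apply, fractVec, Int.fract]
      push_cast
      ring
    change intVec d (fun i => -⌊x i⌋) + x ∈ unitCube d
    rw [← this]
    exact fractVec_mem x
  · rintro ⟨_, κ, rfl⟩ h
    change intVec d κ + x ∈ unitCube d at h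
    congr 1
    ext i
    have := h i
    simp only [Pi.add_apply, intVec_apply, Set.mem_Ico] at this
    have h2 : ⌊x i⌋ = -κ i := Int.floor_eq_iff.2 (by push_cast; constructor <;> linarith)
    simp [h2]

instance : Countable (intVec d).range :=
  (Set.countable_range (intVec d)).to_subtype

theorem IntInvariant.vaddInvariantMeasure (hM : IntInvariant M) :
    VAddInvariantMeasure (intVec d).range (Fin d → ℝ) M := by
  refine ⟨?_⟩
  rintro ⟨_, κ, rfl⟩ s hs
  have h : (fun x : Fin d → ℝ => (⟨intVec d κ, ⟨κ, rfl⟩⟩ : (intVec d).range) +ᵥ x) =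
      fun x => x + intVec d κ := by
    funext x
    exact add_comm _ _
  rw [h]
  exact (hM κ).measure_preimage hs.nullMeasurableSet

/-- A measure preserving homeomorphism commuting with integer translations preserves integrals of
periodic functions over the unit cube. -/
theorem IntInvariant.setIntegral_unitCube_comp (hM : IntInvariant M)
    (T : (Fin d → ℝ) ≃ₜ (Fin d → ℝ)) (hT : MeasurePreserving T M M)
    (hTe : ∀ κ x, T (x + intVec d κ) = T x + intVec d κ) {f : (Fin d → ℝ) → ℝ}
    (hf : ZdPeriodic f) :
    ∫ y in unitCube d, f (T y) ∂M = ∫ y in unitCube d, f y ∂M := by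
  have := hM.vaddInvariantMeasure
  have hQ := isAddFundamentalDomain_unitCube M
  have hQ' : IsAddFundamentalDomain (intVec d).range (T ⁻¹' unitCube d) M := by
    refine hQ.preimage_of_equiv hT.quasiMeasurePreserving (e := id) Function.bijective_id ?_
    rintro ⟨_, κ, rfl⟩ x
    change T (intVec d κ + x) = intVec d κ + T x
    rw [add_comm, hTe, add_comm]
  rw [← hT.setIntegral_preimage_emb T.measurableEmbedding f (unitCube d)]
  refine hQ.setIntegral_eq hQ' ?_
  rintro ⟨_, κ, rfl⟩ x
  change f (T (intVec d κ + x)) = _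
  rw [add_comm, hTe, hf.add_intVec]

end FundamentalDomain

section Unfold

variable {d : ℕ}

/-- The `ℤ^d`-invariant measure on `ℝ^d` associated with a measure on the unit cube. -/
def unfoldMeasure (μ : Measure (Fin d → ℝ)) : Measure (Fin d → ℝ) :=
  Measure.sum fun κ : Fin d → ℤ => μ.map fun x => x + intVec d κ

variable {μ : Measure (Fin d → ℝ)}

theorem intInvariant_unfoldMeasure : IntInvariant (unfoldMeasure μ) := fun κ => by
  have hm : ∀ κ : Fin d → ℤ, Measurable fun x : Fin d → ℝ => x + intVec d κ := fun κ =>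
    measurable_id.add_const _
  refine ⟨hm κ, ?_⟩
  rw [unfoldMeasure, Measure.map_sum (hm κ).aemeasurable]
  simp_rw [Measure.map_map (hm κ) (hm _)]
  ext A hA
  rw [Measure.sum_apply _ hA, Measure.sum_apply _ hA]
  refine Eq.trans ?_ ((Equiv.addRight κ).tsum_eq _)
  refine tsum_congr fun κ' => ?_
  congr 2
  funext x
  simp [add_assoc]

theorem unfoldMeasure_restrict (hμ : μ (unitCube d)ᶜ = 0) :
    (unfoldMeasure μ).restrict (unitCube d) = μ := by
  have hm : ∀ κ : Fin d → ℤ, Measurable fun x : Fin d → ℝ => x + intVec d κ := fun κ =>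
    measurable_id.add_const _
  have hQ := measurableSet_unitCube d
  have hQae : ∀ᵐ y ∂μ, y ∈ unitCube d := by rwa [ae_iff]
  ext A hA
  rw [Measure.restrict_apply hA, unfoldMeasure, Measure.sum_apply _ (hA.inter hQ),
    tsum_eq_single 0]
  · rw [Measure.map_apply (hm 0) (hA.inter hQ)]
    simp only [map_zero, add_zero]
    rw [show (fun x : Fin d → ℝ => x) ⁻¹' (A ∩ unitCube d) = A ∩ unitCube d from rfl]
    refine measure_congr ?_
    filter_upwards [hQae] with x hx
    exact propext ⟨fun h => h.1, fun h => ⟨h, hx⟩⟩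
  · intro κ hκ
    rw [Measure.map_apply (hm κ) (hA.inter hQ)]
    refine measure_mono_null (t := (unitCube d)ᶜ) (fun x hx hxQ => ?_) hμ
    exact hκ (eq_zero_of_mem_unitCube hxQ hx.2)

theorem isLocallyFiniteMeasure_unfoldMeasure [IsFiniteMeasure μ] (hμ : μ (unitCube d)ᶜ = 0) :
    IsLocallyFiniteMeasure (unfoldMeasure μ) := by
  refine ⟨fun x => ⟨Metric.ball x 1, Metric.ball_mem_nhds x one_pos, ?_⟩⟩
  have hm : ∀ κ : Fin d → ℤ, Measurable fun x : Fin d → ℝ => x + intVec d κ := fun κ =>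
    measurable_id.add_const _
  rw [unfoldMeasure, Measure.sum_apply _ Metric.isOpen_ball.measurableSet]
  rw [tsum_eq_sum (s := (finite_norm_intVec_le d (‖x‖ + 2)).toFinset)]
  · refine ENNReal.sum_lt_top.2 fun κ _ => ?_
    rw [Measure.map_apply (hm κ) Metric.isOpen_ball.measurableSet]
    exact measure_lt_top _ _
  · intro κ hκ
    rw [Measure.map_apply (hm κ) Metric.isOpen_ball.measurableSet]
    refine measure_mono_null (t := (unitCube d)ᶜ) (fun y hy hyQ => hκ ?_) hμ
    simp only [Set.Finite.mem_toFinset, Set.mem_ofPred_eq]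
    have h1 := norm_le_of_mem_unitCube hyQ
    simp only [Set.mem_preimage, Metric.mem_ball, dist_eq_norm] at hy
    calc ‖intVec d κ‖ = ‖(y + intVec d κ - x) + x - y‖ := by congr 1; abel
      _ ≤ ‖(y + intVec d κ - x) + x‖ + ‖y‖ := norm_sub_le _ _
      _ ≤ ‖(y + intVec d κ - x)‖ + ‖x‖ + ‖y‖ := by gcongr; exact norm_add_le _ _
      _ ≤ ‖x‖ + 2 := by linarith

/-- The periodization of a function. -/
def periodize (g : (Fin d → ℝ) → ℝ) (y : Fin d → ℝ) : ℝ := ∑ᶠ κ : Fin d → ℤ, g (y + intVec d κ)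

theorem periodize_periodic (g : (Fin d → ℝ) → ℝ) : ZdPeriodic (periodize g) := fun κ x => by
  change periodize g (x + intVec d κ) = periodize g x
  rw [periodize, periodize]
  refine Eq.trans ?_ (finsum_comp_equiv (Equiv.addLeft κ))
  simp [add_assoc]

theorem exists_finset_periodize {g : (Fin d → ℝ) → ℝ} (hg : HasCompactSupport g) (R : ℝ) :
    ∃ s : Finset (Fin d → ℤ), ∀ y, ‖y‖ ≤ R → ∀ κ, κ ∉ s → g (y + intVec d κ) = 0 := by
  obtain ⟨S, hS⟩ := hg.isCompact.isBounded.exists_norm_le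
  refine ⟨(finite_norm_intVec_le d (S + R)).toFinset, fun y hy κ hκ => ?_⟩
  by_contra h
  refine hκ ?_
  simp only [Set.Finite.mem_toFinset, Set.mem_ofPred_eq]
  have h1 := hS _ (subset_tsupport _ h)
  calc ‖intVec d κ‖ = ‖y + intVec d κ - y‖ := by congr 1; abel
    _ ≤ ‖y + intVec d κ‖ + ‖y‖ := norm_sub_le _ _
    _ ≤ S + R := by linarith

theorem periodize_eq_sum {g : (Fin d → ℝ) → ℝ} {s : Finset (Fin d → ℤ)} {y : Fin d → ℝ}
    (h : ∀ κ, κ ∉ s → g (y + intVec d κ) = 0) :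
    periodize g y = ∑ κ ∈ s, g (y + intVec d κ) :=
  finsum_eq_sum_of_support_subset _ fun κ hκ => by
    by_contra h'
    exact hκ (h κ h')

theorem continuous_periodize {g : (Fin d → ℝ) → ℝ} (hg : HasCompactSupport g)
    (hgc : Continuous g) : Continuous (periodize g) := by
  rw [continuous_iff_continuousAt]
  intro x
  obtain ⟨s, hs⟩ := exists_finset_periodize hg (‖x‖ + 1)
  have hev : periodize g =ᶠ[nhds x] fun y => ∑ κ ∈ s, g (y + intVec d κ) := by
    filter_upwards [Metric.ball_mem_nhds x one_pos] with y hy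
    refine periodize_eq_sum (hs y ?_)
    rw [Metric.mem_ball, dist_eq_norm] at hy
    have := norm_sub_norm_le y x
    linarith
  refine ContinuousAt.congr ?_ hev.symm
  exact (continuous_finsetSum _ fun κ _ => hgc.comp (continuous_id.add continuous_const)).continuousAt

theorem integral_unfoldMeasure [IsFiniteMeasure μ] (hμ : μ (unitCube d)ᶜ = 0)
    {g : (Fin d → ℝ) → ℝ} (hg : HasCompactSupport g) (hgc : Continuous g) :
    ∫ y, g y ∂(unfoldMeasure μ) = ∫ y, periodize g y ∂μ := by
  have := isLocallyFiniteMeasure_unfoldMeasure hμ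
  have hm : ∀ κ : Fin d → ℤ, Measurable fun x : Fin d → ℝ => x + intVec d κ := fun κ =>
    measurable_id.add_const _
  have hQ : ∀ᵐ y ∂μ, y ∈ unitCube d := by rwa [ae_iff]
  obtain ⟨s, hs⟩ := exists_finset_periodize hg 1
  have hInt := hgc.integrable_of_hasCompactSupport hg (μ := unfoldMeasure μ)
  have hmap : ∀ κ, ∫ y, g y ∂(μ.map fun x => x + intVec d κ) = ∫ y, g (y + intVec d κ) ∂μ :=
    fun κ => integral_map (hm κ).aemeasurable hgc.aestronglyMeasurable
  obtain ⟨C, hC⟩ := hgc.bounded_above_of_compact_support hg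
  have hi : ∀ κ, Integrable (fun y => g (y + intVec d κ)) μ := fun κ =>
    Integrable.of_bound (hgc.comp (continuous_id.add continuous_const)).aestronglyMeasurable C
      (ae_of_all _ fun y => hC _)
  rw [unfoldMeasure, integral_sum_measure hInt]
  simp_rw [hmap]
  rw [tsum_eq_sum (s := s), ← integral_finsetSum _ fun κ _ => hi κ]
  · refine integral_congr_ae ?_
    filter_upwards [hQ] with y hy
    exact (periodize_eq_sum (hs y (norm_le_of_mem_unitCube hy))).symm
  · intro κ hκ
    refine integral_eq_zero_of_ae ?_
    filter_upwards [hQ] with y hy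
    exact hs y (norm_le_of_mem_unitCube hy) κ hκ

end Unfold

/-- An invariant measure on the torus lifts to an invariant measure on `ℝ^d`. -/
theorem IsFlowOf.map_unfoldMeasure {d : ℕ} {F : (Fin d → ℝ) → (Fin d → ℝ)}
    {Y : ℝ → (Fin d → ℝ) → (Fin d → ℝ)} {K : NNReal} (hY : IsFlowOf F Y)
    (hF : LipschitzWith K F) (hp : ZdPeriodic F) {μ : Measure (Fin d → ℝ)} [IsFiniteMeasure μ]
    (hμ : μ (unitCube d)ᶜ = 0) (hinv : FlowInvariant Y μ) (t : ℝ) :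
    (unfoldMeasure μ).map (Y t) = unfoldMeasure μ := by
  have := isLocallyFiniteMeasure_unfoldMeasure hμ
  have hloc := hY.isLocallyFiniteMeasure_map hF (unfoldMeasure μ) t
  refine Measure.ext_of_integral_lipschitz_eq fun g L hg hgc => ?_
  rw [integral_map (hY.continuous_space hF t).aemeasurable hg.continuous.aestronglyMeasurable]
  have hc : HasCompactSupport fun y => g (Y t y) :=
    hgc.comp_homeomorph (hY.homeomorph hF t)
  rw [integral_unfoldMeasure hμ hc (hg.continuous.comp (hY.continuous_space hF t)),
    integral_unfoldMeasure hμ hgc hg.continuous,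
    ← hinv t _ (continuous_periodize hgc hg.continuous) (periodize_periodic g)]
  refine integral_congr_ae (ae_of_all _ fun y => ?_)
  simp only [periodize]
  refine finsum_congr fun κ => ?_
  congr 1
  exact hY.equivariant hF hp κ t y

/-- A Lipschitz function has the same derivative along two curves with the same tangent. -/
theorem LipschitzWith.hasDerivAt_comp_of_tangent {E : Type*} [NormedAddCommGroup E]
    [NormedSpace ℝ E] {ψ : E → ℝ} {L : NNReal} (hψ : LipschitzWith L ψ) {γ₁ γ₂ : ℝ → E} {t₀ : ℝ}
    {w : E} {c : ℝ} (h1 : HasDerivAt γ₁ w t₀) (h2 : HasDerivAt γ₂ w t₀) (h0 : γ₁ t₀ = γ₂ t₀)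
    (h : HasDerivAt (fun t => ψ (γ₁ t)) c t₀) : HasDerivAt (fun t => ψ (γ₂ t)) c t₀ := by
  have hz : HasDerivAt (fun t => ψ (γ₂ t) - ψ (γ₁ t)) 0 t₀ := by
    rw [hasDerivAt_iff_isLittleO]
    have h3 := hasDerivAt_iff_isLittleO.1 (h2.sub h1)
    refine Asymptotics.IsBigO.trans_isLittleO (Asymptotics.IsBigO.of_bound L ?_) h3
    refine Eventually.of_forall fun t => ?_
    simp only [Pi.sub_apply, h0, sub_self, smul_zero, sub_zero]
    exact hψ.norm_sub_le _ _
  have h4 := hz.add h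
  rw [zero_add] at h4
  convert! h4 using 1
  funext t
  simp

/-- If `M` is invariant under the flow of `g v`, then the measure with density `g` with respect to
`M` is invariant under the flow of `v`. -/
theorem IsFlowOf.map_withDensity_of_invariant {d : ℕ} {v : (Fin d → ℝ) → (Fin d → ℝ)}
    {Kv : NNReal} (hvL : LipschitzWith Kv v) {Cv : ℝ} (hvC : ∀ x, ‖v x‖ ≤ Cv)
    {Z : ℝ → (Fin d → ℝ) → (Fin d → ℝ)} (hZ : IsFlowOf v Z)
    {g : (Fin d → ℝ) → ℝ} (hg : Continuous g) (hg0 : ∀ x, 0 ≤ g x)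
    {Y : ℝ → (Fin d → ℝ) → (Fin d → ℝ)} (hY : IsFlowOf (fun y => g y • v y) Y)
    {K : NNReal} (hF : LipschitzWith K fun y => g y • v y) {C : ℝ} (hC : ∀ x, ‖g x • v x‖ ≤ C)
    {M : Measure (Fin d → ℝ)} [IsLocallyFiniteMeasure M] (hM : ∀ t, M.map (Y t) = M)
    [IsLocallyFiniteMeasure (M.withDensity fun y => ENNReal.ofReal (g y))] (τ : ℝ) :
    (M.withDensity fun y => ENNReal.ofReal (g y)).map (Z τ) =
      M.withDensity fun y => ENNReal.ofReal (g y) := by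
  have hloc := hZ.isLocallyFiniteMeasure_map hvL (M.withDensity fun y => ENNReal.ofReal (g y)) τ
  refine Measure.ext_of_integral_lipschitz_eq fun f L hf hfc => ?_
  rw [integral_map (hZ.continuous_space hvL τ).aemeasurable hf.continuous.aestronglyMeasurable]
  have hC0 : 0 ≤ C := (norm_nonneg _).trans (hC 0)
  have hZc := hZ.continuous_uncurry hvL hvC
  have hfZ : ∀ y, Continuous fun s => f (Z s y) := fun y =>
    hf.continuous.comp (hZ.continuous_time y)
  set ψ : (Fin d → ℝ) → ℝ := fun y => ∫ s in (0 : ℝ)..τ, f (Z s y) with hψdef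
  have hψL : LipschitzWith (L * (Real.exp (Kv * |τ|)).toNNReal * ‖τ‖₊) ψ := by
    refine LipschitzWith.of_dist_le_mul fun x y => ?_
    rw [dist_eq_norm, hψdef]
    simp only
    rw [← intervalIntegral.integral_sub ((hfZ x).intervalIntegrable _ _)
      ((hfZ y).intervalIntegrable _ _)]
    have hb : ∀ s ∈ Set.uIoc (0 : ℝ) τ, ‖f (Z s x) - f (Z s y)‖ ≤
        L * (Real.exp (Kv * |τ|)).toNNReal * dist x y := by
      intro s hs
      have hsτ : |s| ≤ |τ| := by
        have := Set.abs_sub_left_of_mem_uIcc (Set.uIoc_subset_uIcc hs)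
        simpa using this
      rw [← dist_eq_norm, mul_assoc]
      refine (hf.dist_le_mul _ _).trans (mul_le_mul_of_nonneg_left ?_ L.coe_nonneg)
      refine ((hZ.lipschitz hvL s).dist_le_mul _ _).trans
        (mul_le_mul_of_nonneg_right ?_ dist_nonneg)
      rw [NNReal.coe_le_coe]
      exact Real.toNNReal_mono (Real.exp_le_exp.2 (mul_le_mul_of_nonneg_left hsτ Kv.coe_nonneg))
    refine (intervalIntegral.norm_integral_le_of_norm_le_const hb).trans (le_of_eq ?_)
    push_cast
    rw [sub_zero, Real.norm_eq_abs]
    ring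
  have hψc : HasCompactSupport ψ := by
    obtain ⟨hKc, hK0⟩ := hZ.hasCompactSupport_comp hvC hfc |τ|
    refine HasCompactSupport.intro hKc fun y hy => ?_
    rw [hψdef]
    refine (intervalIntegral.integral_congr fun s hs => ?_).trans intervalIntegral.integral_zero
    refine hK0 s ?_ y hy
    simpa using Set.abs_sub_left_of_mem_uIcc hs
  set G : (Fin d → ℝ) → ℝ := fun y => f (Z τ y) - f y with hG
  have hGc : Continuous G := (hf.continuous.comp (hZ.continuous_space hvL τ)).sub hf.continuous
  have hψZ : ∀ p, HasDerivAt (fun r => ψ (Z r p)) (G p) 0 := by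
    intro p
    have h1 : (fun r => ψ (Z r p)) = fun r => (∫ s in (0 : ℝ)..(r + τ), f (Z s p)) -
        ∫ s in (0 : ℝ)..r, f (Z s p) := by
      funext r
      rw [hψdef]
      simp only
      simp_rw [← hZ.add_apply hvL]
      rw [intervalIntegral.integral_comp_add_right (fun s => f (Z s p)) r, zero_add, add_comm τ r,
        intervalIntegral.integral_interval_sub_left ((hfZ p).intervalIntegrable _ _)
        ((hfZ p).intervalIntegrable _ _)]
    rw [h1]
    have h2 : ∀ r, HasDerivAt (fun r => ∫ s in (0 : ℝ)..r, f (Z s p)) (f (Z r p)) r := fun r =>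
      intervalIntegral.integral_hasDerivAt_right ((hfZ p).intervalIntegrable _ _)
        ((hfZ p).stronglyMeasurableAtFilter _ _) (hfZ p).continuousAt
    have h3 := HasDerivAt.comp_add_const (𝕜 := ℝ) 0 τ (h2 (0 + τ))
    have h4 := h3.sub (h2 0)
    rw [(hZ p).1, zero_add] at h4
    exact h4
  have hψY : ∀ p, HasDerivAt (fun t => ψ (Y t p)) (g p * G p) 0 := by
    intro p
    have hY0 := (hY p).2 0
    rw [(hY p).1] at hY0
    have hlin : HasDerivAt (fun t : ℝ => t * g p) (g p) 0 := by
      simpa using (hasDerivAt_id (0 : ℝ)).mul_const (g p)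
    have hZ0 : HasDerivAt (fun t => Z (t * g p) p) (g p • v p) 0 := by
      have h1 := (hZ p).2 (0 * g p)
      rw [zero_mul, (hZ p).1] at h1
      exact HasDerivAt.scomp_of_eq 0 h1 hlin (by simp)
    refine hψL.hasDerivAt_comp_of_tangent hZ0 hY0 (by simp [(hZ p).1, (hY p).1]) ?_
    have h1 := HasDerivAt.comp_of_eq (h₂ := fun r => ψ (Z r p)) 0 (hψZ p) hlin (by simp)
    rw [mul_comm]
    exact h1
  have hcont : ∀ s, Continuous fun y => ψ (Y s y) := fun s =>
    hψL.continuous.comp (hY.continuous_space hF s)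
  obtain ⟨hKc, hK0⟩ := hY.hasCompactSupport_comp hC hψc 1
  set K' := Metric.cthickening (C * 1) (tsupport ψ)
  have hder : HasDerivAt (fun t => ∫ y, ψ (Y t y) ∂M) (∫ y, g y * G y ∂M) 0 := by
    have hψc0 : HasCompactSupport fun y => ψ (Y 0 y) :=
      HasCompactSupport.intro hKc fun y hy => hK0 0 (by simp) y hy
    set L' : NNReal := L * (Real.exp (Kv * |τ|)).toNNReal * ‖τ‖₊
    refine (hasDerivAt_integral_of_dominated_loc_of_lip (s := Metric.ball 0 1)
      (bound := K'.indicator fun _ => L' * C) (Metric.ball_mem_nhds 0 one_pos)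
      (Eventually.of_forall fun s => (hcont s).aestronglyMeasurable)
      ((hcont 0).integrable_of_hasCompactSupport hψc0) (hg.mul hGc).aestronglyMeasurable
      ?_ ?_ (ae_of_all _ hψY)).2
    · refine ae_of_all _ fun y => ?_
      refine LipschitzOnWith.of_dist_le_mul fun s hs s' hs' => ?_
      by_cases hy : y ∈ K'
      · rw [Set.indicator_of_mem hy, Real.coe_nnabs, abs_of_nonneg (mul_nonneg L'.coe_nonneg hC0),
          mul_assoc]
        refine (hψL.dist_le_mul _ _).trans (mul_le_mul_of_nonneg_left ?_ L'.coe_nonneg)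
        rw [dist_eq_norm]
        exact hY.dist_le hC s' s y
      · have hle : ∀ s ∈ Metric.ball (0 : ℝ) 1, |s| ≤ 1 := fun s hs => by
          rw [Metric.mem_ball, Real.dist_eq, sub_zero] at hs
          exact hs.le
        rw [hK0 s (hle s hs) y hy, hK0 s' (hle s' hs') y hy]
        simp [hy]
    · exact (integrable_indicator_iff Metric.isClosed_cthickening.measurableSet).2
        (integrableOn_const hKc.measure_lt_top.ne)
  have hconst : (fun t => ∫ y, ψ (Y t y) ∂M) = fun _ => ∫ y, ψ y ∂M := by
    funext t
    conv_rhs => rw [← hM t]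
    rw [integral_map (hY.continuous_space hF t).aemeasurable hψL.continuous.aestronglyMeasurable]
  rw [hconst] at hder
  have h0 := hder.unique (hasDerivAt_const _ _)
  have hfτ : HasCompactSupport fun y => f (Z τ y) := hfc.comp_homeomorph (hZ.homeomorph hvL τ)
  have hfτc := hf.continuous.comp (hZ.continuous_space hvL τ)
  have hw : ∀ h : (Fin d → ℝ) → ℝ, ∫ y, h y ∂(M.withDensity fun y => ENNReal.ofReal (g y)) =
      ∫ y, g y * h y ∂M := fun h => by
    rw [integral_withDensity_eq_integral_toReal_smul hg.measurable.ennreal_ofReal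
      (ae_of_all _ fun _ => ENNReal.ofReal_lt_top)]
    simp_rw [ENNReal.toReal_ofReal (hg0 _), smul_eq_mul]
  rw [hw, hw, ← sub_eq_zero, ← integral_sub]
  · simp_rw [← mul_sub]
    exact h0
  · exact (hg.mul hfτc).integrable_of_hasCompactSupport hfτ.mul_left
  · exact (hg.mul hf.continuous).integrable_of_hasCompactSupport hfc.mul_left

theorem fderiv_apply_eq_dotProduct {d : ℕ} (u : (Fin d → ℝ) → ℝ) (y w : Fin d → ℝ) :
    fderiv ℝ u y w = w ⬝ᵥ grad u y := clm_apply_eq_sum _ _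

theorem Rperp_dotProduct_Rperp (v w : Fin 2 → ℝ) : Rperp v ⬝ᵥ Rperp w = v ⬝ᵥ w := by
  simp [Rperp, dotProduct, Fin.sum_univ_two]
  ring

theorem Rperp_dotProduct_self (v : Fin 2 → ℝ) : Rperp v ⬝ᵥ v = 0 := by
  simp [Rperp, dotProduct, Fin.sum_univ_two]
  ring

/-- `R⊥` as a continuous linear map. -/
def RperpL : (Fin 2 → ℝ) →L[ℝ] (Fin 2 → ℝ) :=
  LinearMap.toContinuousLinearMap
    { toFun := Rperp
      map_add' := fun v w => by
        ext i
        fin_cases i <;> simp [Rperp]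
        ring
      map_smul' := fun c v => by
        ext i
        fin_cases i <;> simp [Rperp] }

theorem Rperp_eq_zero {v : Fin 2 → ℝ} (h : Rperp v = 0) : v = 0 := by
  have h0 := congrFun h 0
  have h1 := congrFun h 1
  simp only [Rperp, cons_val_zero, Pi.zero_apply, cons_val_one, neg_eq_zero] at h0 h1
  ext i
  fin_cases i
  · exact h1
  · exact h0

theorem dotProduct_self_pos_of_ne_zero {d : ℕ} {v : Fin d → ℝ} (hv : v ≠ 0) : 0 < v ⬝ᵥ v :=
  lt_of_le_of_ne (Finset.sum_nonneg fun _ _ => mul_self_nonneg _)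
    fun h => hv (dotProduct_self_eq_zero.1 h.symm)

theorem abs_dotProduct_le (v w : Fin 2 → ℝ) : |v ⬝ᵥ w| ≤ 2 * (‖v‖ * ‖w‖) := by
  rw [dotProduct, Fin.sum_univ_two]
  refine (abs_add_le _ _).trans ?_
  rw [abs_mul, abs_mul, two_mul]
  have h : ∀ (x : Fin 2 → ℝ) i, |x i| ≤ ‖x‖ := fun x i => norm_le_pi_norm x i
  gcongr <;> apply h

theorem continuous_dotProduct_of {X : Type*} [TopologicalSpace X] {d : ℕ} {f g : X → Fin d → ℝ}
    (hf : Continuous f) (hg : Continuous g) : Continuous fun x => f x ⬝ᵥ g x :=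
  hf.dotProduct hg

/-- A function whose gradient is periodic, nonvanishing, and has mean with rationally independent
coordinates. -/
structure IsStream (u : (Fin 2 → ℝ) → ℝ) : Prop where
  contDiff : ContDiff ℝ 2 u
  periodic : ZdPeriodic fun y => grad u y
  ne_zero : ∀ y, grad u y ≠ 0
  ergodic : ∀ κ : Fin 2 → ℤ, κ ≠ 0 →
    (∫ y in unitCube 2, grad u y) ⬝ᵥ (fun i => (κ i : ℝ)) ≠ 0

namespace IsStream

variable {u : (Fin 2 → ℝ) → ℝ} (hu : IsStream u)

include hu

theorem hasFDerivAt (y : Fin 2 → ℝ) : HasFDerivAt u (fderiv ℝ u y) y :=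
  (hu.contDiff.differentiable (by norm_num) y).hasFDerivAt

theorem contDiff_grad : ContDiff ℝ 1 (grad u) :=
  contDiff_pi.2 fun _ => (hu.contDiff.fderiv_right (m := 1) (by norm_num)).clm_apply contDiff_const

theorem contDiff_Rperp : ContDiff ℝ 1 fun y => Rperp (grad u y) :=
  RperpL.contDiff.comp hu.contDiff_grad

theorem periodic_Rperp : ZdPeriodic fun y => Rperp (grad u y) := fun κ x =>
  congrArg Rperp (hu.periodic κ x)

theorem div_Rperp (x : Fin 2 → ℝ) :
    ∑ i, fderiv ℝ (fun y => Rperp (grad u y)) x (Pi.single i 1) i = 0 := by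
  have hd : ∀ i : Fin 2, HasFDerivAt (fun y => grad u y i)
      ((fderiv ℝ (fderiv ℝ u) x).flip (Pi.single i 1)) x := fun i => by
    have h1 : HasFDerivAt (fderiv ℝ u) (fderiv ℝ (fderiv ℝ u) x) x :=
      ((hu.contDiff.fderiv_right (m := 1) (by norm_num)).differentiable (by norm_num) x).hasFDerivAt
    have h2 := h1.clm_apply (hasFDerivAt_const (Pi.single i (1 : ℝ)) x)
    simpa using! h2
  have hV : HasFDerivAt (fun y => Rperp (grad u y))
      (ContinuousLinearMap.pi ![(fderiv ℝ (fderiv ℝ u) x).flip (Pi.single 1 1),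
        -(fderiv ℝ (fderiv ℝ u) x).flip (Pi.single 0 1)]) x := by
    rw [hasFDerivAt_pi']
    intro i
    fin_cases i
    · exact hd 1
    · exact (hd 0).neg
  rw [hV.fderiv, Fin.sum_univ_two]
  have hsymm : IsSymmSndFDerivAt ℝ u x :=
    hu.contDiff.contDiffAt.isSymmSndFDerivAt (by simp)
  have := hsymm (Pi.single 0 1) (Pi.single 1 1)
  simp [this]

theorem exists_lower_bound : ∃ n₀ > 0, ∀ y, n₀ ≤ grad u y ⬝ᵥ grad u y := by
  have hc : Continuous fun y => grad u y ⬝ᵥ grad u y :=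
    continuous_dotProduct_of hu.contDiff_grad.continuous hu.contDiff_grad.continuous
  obtain ⟨y₀, -, hy₀⟩ := (isCompact_closedBall (0 : Fin 2 → ℝ) 1).exists_isMinOn
    ⟨0, by simp⟩ hc.continuousOn
  refine ⟨_, dotProduct_self_pos_of_ne_zero (hu.ne_zero y₀), fun y => ?_⟩
  have hp : ZdPeriodic fun y => grad u y ⬝ᵥ grad u y := fun κ x => by
    have := hu.periodic κ x
    simp only at this ⊢
    rw [this]
  rw [← hp.apply_fractVec y]
  exact hy₀ (by simpa using norm_le_of_mem_unitCube (fractVec_mem y))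

theorem exists_flow_grad_div : ∃ (C : ℝ) (K : NNReal) (W : ℝ → (Fin 2 → ℝ) → (Fin 2 → ℝ)),
    0 < C ∧ LipschitzWith K (fun y => (grad u y ⬝ᵥ grad u y)⁻¹ • grad u y) ∧
    (∀ y, ‖(grad u y ⬝ᵥ grad u y)⁻¹ • grad u y‖ ≤ C) ∧
    IsFlowOf (fun y => (grad u y ⬝ᵥ grad u y)⁻¹ • grad u y) W := by
  set w := fun y => (grad u y ⬝ᵥ grad u y)⁻¹ • grad u y with hw
  have hp : ZdPeriodic w := fun κ x => by
    have := hu.periodic κ x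
    simp only [hw] at this ⊢
    rw [this]
  have hn : ContDiff ℝ 1 fun y => grad u y ⬝ᵥ grad u y := by
    have hi := contDiff_pi.1 hu.contDiff_grad
    exact ContDiff.sum fun i _ => (hi i).mul (hi i)
  have hwc : ContDiff ℝ 1 w :=
    (hn.inv fun y => (dotProduct_self_pos_of_ne_zero (hu.ne_zero y)).ne').smul hu.contDiff_grad
  obtain ⟨C, hC⟩ := hp.bounded hwc.continuous
  obtain ⟨K, hK⟩ := hp.lipschitz hwc
  obtain ⟨W, hW⟩ := exists_isFlowOf hK hC
  exact ⟨max C 1, K, W, by positivity, hK, fun y => (hC y).trans (le_max_left _ _), hW⟩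

theorem apply_flow {Z : ℝ → (Fin 2 → ℝ) → (Fin 2 → ℝ)}
    (hZ : IsFlowOf (fun y => Rperp (grad u y)) Z) (t : ℝ) (x : Fin 2 → ℝ) : u (Z t x) = u x := by
  have hd : ∀ t, HasDerivAt (fun s => u (Z s x)) 0 t := fun t => by
    have h := HasFDerivAt.comp_hasDerivAt (l := u) (f := fun s => Z s x) t
      (hu.hasFDerivAt _) ((hZ x).2 t)
    rw [fderiv_apply_eq_dotProduct, Rperp_dotProduct_self] at h
    exact h
  have := is_const_of_deriv_eq_zero (fun s => (hd s).differentiableAt) (fun s => (hd s).deriv) t 0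
  rw [this, (hZ x).1]

theorem apply_transverse {W : ℝ → (Fin 2 → ℝ) → (Fin 2 → ℝ)}
    (hW : IsFlowOf (fun y => (grad u y ⬝ᵥ grad u y)⁻¹ • grad u y) W) (s : ℝ) (x : Fin 2 → ℝ) :
    u (W s x) = u x + s := by
  have hd : ∀ t, HasDerivAt (fun s => u (W s x) - s) 0 t := fun t => by
    have h := HasFDerivAt.comp_hasDerivAt (l := u) (f := fun s => W s x) t
      (hu.hasFDerivAt _) ((hW x).2 t)
    rw [fderiv_apply_eq_dotProduct, smul_dotProduct, smul_eq_mul,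
      inv_mul_cancel₀ (dotProduct_self_pos_of_ne_zero (hu.ne_zero _)).ne'] at h
    simpa using! h.sub (hasDerivAt_id t)
  have := is_const_of_deriv_eq_zero (fun s => (hd s).differentiableAt) (fun s => (hd s).deriv) s 0
  rw [(hW x).1] at this
  linarith

theorem exists_dotProduct_lower_bound : ∃ n > 0, ∃ δ > 0, ∀ p x, ‖x - p‖ ≤ δ →
    n ≤ grad u x ⬝ᵥ grad u p := by
  obtain ⟨n₀, hn₀, hn⟩ := hu.exists_lower_bound
  obtain ⟨C, hC⟩ := hu.periodic.bounded hu.contDiff_grad.continuous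
  obtain ⟨K, hK⟩ := hu.periodic.lipschitz hu.contDiff_grad
  have hC0 : 0 ≤ C := (norm_nonneg _).trans (hC 0)
  refine ⟨n₀ / 2, by positivity, n₀ / (4 * (K * C + 1)), by positivity, fun p x hx => ?_⟩
  have h1 : grad u x ⬝ᵥ grad u p = grad u p ⬝ᵥ grad u p + (grad u x - grad u p) ⬝ᵥ grad u p := by
    rw [sub_dotProduct]
    ring
  have h2 := abs_dotProduct_le (grad u x - grad u p) (grad u p)
  have h3 : ‖grad u x - grad u p‖ * ‖grad u p‖ ≤ K * ‖x - p‖ * C :=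
    mul_le_mul (hK.norm_sub_le x p) (hC p) (norm_nonneg _) (by positivity)
  have h4 : K * ‖x - p‖ * C ≤ n₀ / 4 := by
    calc K * ‖x - p‖ * C = (K * C) * ‖x - p‖ := by ring
      _ ≤ (K * C + 1) * (n₀ / (4 * (K * C + 1))) := by gcongr; linarith
      _ = n₀ / 4 := by field_simp
  have h5 := neg_abs_le ((grad u x - grad u p) ⬝ᵥ grad u p)
  have h6 := hn p
  rw [h1]
  linarith

/-- Nearby points on the same level set of `u` lie on the same trajectory. -/
theorem exists_flow_eq {Z : ℝ → (Fin 2 → ℝ) → (Fin 2 → ℝ)}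
    (hZ : IsFlowOf (fun y => Rperp (grad u y)) Z) :
    ∃ r > 0, ∀ p q, ‖q - p‖ ≤ r → u q = u p → ∃ t, q = Z t p := by
  obtain ⟨n, hn0, δ, hδ, hn⟩ := hu.exists_dotProduct_lower_bound
  obtain ⟨C', hC'⟩ := hu.periodic_Rperp.bounded hu.contDiff_Rperp.continuous
  set C := max C' 1
  have hC0 : 0 < C := by positivity
  have hC : ∀ x, ‖Rperp (grad u x)‖ ≤ C := fun x => (hC' x).trans (le_max_left _ _)
  set T := δ / C with hT
  have hT0 : 0 < T := by positivity
  have hCT : C * T = δ := by rw [hT]; field_simp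
  refine ⟨min δ (n * T / (2 * C)), by positivity, fun p q hqp huq => ?_⟩
  have hq1 := hqp.trans (min_le_left _ _)
  have hq2 := hqp.trans (min_le_right _ _)
  set φ : ℝ → ℝ := fun t => (Z t p - q) ⬝ᵥ Rperp (grad u p) with hφ
  have hφd : ∀ t, HasDerivAt φ (Rperp (grad u (Z t p)) ⬝ᵥ Rperp (grad u p)) t := fun t => by
    have h1 := hasDerivAt_pi.1 ((hZ p).2 t)
    exact HasDerivAt.fun_sum fun i _ => ((h1 i).sub_const (q i)).mul_const _
  have hZδ : ∀ t, |t| ≤ T → ‖Z t p - p‖ ≤ δ := fun t ht =>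
    (hZ.norm_sub_le hC t p).trans ((mul_le_mul_of_nonneg_left ht hC0.le).trans hCT.le)
  have hφ' : ∀ t ∈ Set.Icc (-T) T, n ≤ deriv φ t := fun t ht => by
    rw [(hφd t).deriv, Rperp_dotProduct_Rperp]
    exact hn _ _ (hZδ t (abs_le.2 ht))
  have hmv := (convex_Icc (-T) T).mul_sub_le_image_sub_of_le_deriv (f := φ)
    (fun t _ => (hφd t).continuousAt.continuousWithinAt)
    (fun t _ => (hφd t).differentiableAt.differentiableWithinAt)
    (fun t ht => hφ' t (interior_subset ht))
  have hφ0 : |φ 0| ≤ n * T := by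
    refine (abs_dotProduct_le _ _).trans ?_
    rw [(hZ p).1, norm_sub_rev]
    calc 2 * (‖q - p‖ * ‖Rperp (grad u p)‖) ≤ 2 * (n * T / (2 * C) * C) := by
          gcongr
          exact hC p
      _ = n * T := by field_simp
  have hb := abs_le.1 hφ0
  have h1 := hmv 0 ⟨by linarith, hT0.le⟩ T ⟨by linarith, le_rfl⟩ hT0.le
  have h2 := hmv (-T) ⟨le_rfl, by linarith⟩ 0 ⟨by linarith, hT0.le⟩ (by linarith)
  have hcφ : Continuous φ := continuous_iff_continuousAt.2 fun t => (hφd t).continuousAt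
  obtain ⟨t, ht, ht0⟩ : (0 : ℝ) ∈ φ '' Set.Icc (-T) T :=
    intermediate_value_Icc (by linarith) hcφ.continuousOn ⟨by linarith, by linarith⟩
  refine ⟨t, ?_⟩
  set z := Z t p - q with hz
  have hpar : (grad u p ⬝ᵥ grad u p) • z = (z ⬝ᵥ grad u p) • grad u p := by
    have h0 : z 0 * grad u p 1 - z 1 * grad u p 0 = 0 := by
      have : φ t = z ⬝ᵥ Rperp (grad u p) := rfl
      rw [← ht0, this]
      simp [Rperp, dotProduct, Fin.sum_univ_two]
      ring
    ext i
    simp only [dotProduct, Fin.sum_univ_two, Pi.smul_apply, smul_eq_mul]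
    fin_cases i
    · simp only [Fin.zero_eta]
      linear_combination (grad u p 1) * h0
    · simp only [Fin.mk_one]
      linear_combination (-grad u p 0) * h0
  have hcurve : ∀ s : ℝ, HasDerivAt (fun s : ℝ => u (q + s • z)) (z ⬝ᵥ grad u (q + s • z)) s := by
    intro s
    have h3 : HasDerivAt (fun s : ℝ => q + s • z) z s := by
      simpa using ((hasDerivAt_id s).smul_const z).const_add q
    have h4 := HasFDerivAt.comp_hasDerivAt (l := u) s (hu.hasFDerivAt _) h3
    rw [fderiv_apply_eq_dotProduct] at h4
    exact h4
  have hends : u (q + (0 : ℝ) • z) = u (q + (1 : ℝ) • z) := by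
    rw [zero_smul, add_zero, one_smul, hz, add_sub_cancel, hu.apply_flow hZ, huq]
  obtain ⟨s, hs, hs0⟩ := exists_hasDerivAt_eq_zero (f := fun s : ℝ => u (q + s • z)) one_pos
    (fun s _ => (hcurve s).continuousAt.continuousWithinAt) hends fun s _ => hcurve s
  have hball : ‖q + s • z - p‖ ≤ δ := by
    have hq' : q + s • z - p = (1 - s) • (q - p) + s • (Z t p - p) := by
      rw [hz]
      module
    rw [hq']
    refine (norm_add_le _ _).trans ?_
    rw [norm_smul, norm_smul, Real.norm_of_nonneg hs.1.le, Real.norm_of_nonneg (by linarith [hs.2])]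
    have := hZδ t (abs_le.2 ht)
    nlinarith [hs.1, hs.2]
  have hpos := hn p _ hball
  have hzero : z ⬝ᵥ grad u p = 0 := by
    have h5 : (grad u p ⬝ᵥ grad u p) * (z ⬝ᵥ grad u (q + s • z)) =
        (z ⬝ᵥ grad u p) * (grad u (q + s • z) ⬝ᵥ grad u p) := by
      rw [← smul_eq_mul, ← smul_dotProduct, hpar, smul_dotProduct, smul_eq_mul,
        dotProduct_comm (grad u p) (grad u (q + s • z))]
    rw [hs0, mul_zero] at h5
    exact (mul_eq_zero.1 h5.symm).resolve_right (by linarith)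
  rw [hzero, zero_smul] at hpar
  have hz0 := (smul_eq_zero.1 hpar).resolve_left
    (dotProduct_self_pos_of_ne_zero (hu.ne_zero p)).ne'
  exact (sub_eq_zero.1 (hz.symm.trans hz0)).symm

end IsStream

namespace IsStream

variable {u : (Fin 2 → ℝ) → ℝ} (hu : IsStream u)

include hu

/-- The mean of `∇u` over the unit cube gives the increments of `u` under integer translations. -/
theorem apply_add_intVec (κ : Fin 2 → ℤ) (x : Fin 2 → ℝ) :
    u (x + intVec 2 κ) = u x + (∫ y in unitCube 2, grad u y) ⬝ᵥ intVec 2 κ := by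
  have hd0 : ∀ x, HasFDerivAt (fun x => u (x + intVec 2 κ) - u x) 0 x := fun x => by
    have h1 := ((hasFDerivAt_comp_add_right (𝕜 := ℝ) (intVec 2 κ)).2
      (hu.hasFDerivAt (x + intVec 2 κ))).sub (hu.hasFDerivAt x)
    have h2 : fderiv ℝ u (x + intVec 2 κ) - fderiv ℝ u x = 0 := by
      ext w
      simp only [_root_.sub_apply, fderiv_apply_eq_dotProduct, _root_.zero_apply]
      have := hu.periodic.add_intVec κ x
      rw [this, sub_self]
    rw [h2] at h1
    exact h1
  have hconst : ∀ x, u (x + intVec 2 κ) - u x = u (0 + intVec 2 κ) - u 0 := fun x =>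
    is_const_of_fderiv_eq_zero (𝕜 := ℝ) (fun y => (hd0 y).differentiableAt)
      (fun y => (hd0 y).fderiv) x 0
  have hgc := hu.contDiff_grad.continuous
  have hcont : Continuous fun p : (Fin 2 → ℝ) × ℝ => intVec 2 κ ⬝ᵥ grad u (p.1 + p.2 • intVec 2 κ) :=
    continuous_dotProduct_of continuous_const
      (hgc.comp (continuous_fst.add (continuous_snd.smul continuous_const)))
  have hInt : ∀ x, u (x + intVec 2 κ) - u x =
      ∫ t in (0 : ℝ)..1, intVec 2 κ ⬝ᵥ grad u (x + t • intVec 2 κ) := fun x => by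
    have hcurve : ∀ s : ℝ, HasDerivAt (fun s : ℝ => u (x + s • intVec 2 κ))
        (intVec 2 κ ⬝ᵥ grad u (x + s • intVec 2 κ)) s := by
      intro s
      have h3 : HasDerivAt (fun s : ℝ => x + s • intVec 2 κ) (intVec 2 κ) s := by
        simpa using ((hasDerivAt_id s).smul_const (intVec 2 κ)).const_add x
      have h4 := HasFDerivAt.comp_hasDerivAt (l := u) s (hu.hasFDerivAt _) h3
      rw [fderiv_apply_eq_dotProduct] at h4
      exact h4
    rw [intervalIntegral.integral_eq_sub_of_hasDerivAt (fun s _ => hcurve s)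
      ((hcont.comp (continuous_const.prodMk continuous_id)).intervalIntegrable _ _)]
    simp
  have hQfin : volume (unitCube 2) ≠ ⊤ := by simp [volume_unitCube]
  have havg : u (0 + intVec 2 κ) - u 0 =
      ∫ x in unitCube 2, ∫ t in (0 : ℝ)..1, intVec 2 κ ⬝ᵥ grad u (x + t • intVec 2 κ) := by
    simp_rw [← hInt, hconst]
    rw [setIntegral_const]
    simp [measureReal_def, volume_unitCube]
  obtain ⟨C, hC⟩ := hu.periodic.bounded hgc
  have hgint : IntegrableOn (grad u) (unitCube 2) :=
    Measure.integrableOn_of_bounded hQfin hgc.aestronglyMeasurable (ae_of_all _ hC)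
  have hinner : ∀ t : ℝ, ∫ x in unitCube 2, intVec 2 κ ⬝ᵥ grad u (x + t • intVec 2 κ) =
      (∫ y in unitCube 2, grad u y) ⬝ᵥ intVec 2 κ := by
    intro t
    have hper : ZdPeriodic fun y => intVec 2 κ ⬝ᵥ grad u y := fun κ' x => by
      have := hu.periodic κ' x
      simp only at this ⊢
      rw [this]
    have h1 := (intInvariant_volume 2).setIntegral_unitCube_comp
      (Homeomorph.addRight (t • intVec 2 κ)) (measurePreserving_add_right volume _)
      (fun κ' x => by simp only [Homeomorph.coe_addRight]; abel) hper
    simp only [Homeomorph.coe_addRight] at h1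
    rw [h1]
    simp only [dotProduct]
    rw [integral_finsetSum]
    · refine Finset.sum_congr rfl fun i _ => ?_
      rw [integral_const_mul, mul_comm, eval_integral fun i => Integrable.eval hgint i]
    · intro i _
      exact (Integrable.eval hgint i).const_mul _
  have hx := hconst x
  rw [havg, ← intervalIntegral_integral_swap] at hx
  · simp_rw [hinner] at hx
    rw [intervalIntegral.integral_const] at hx
    simp only [sub_zero, one_smul] at hx
    linarith
  · have hfin : IsFiniteMeasure ((volume.restrict (Set.uIoc (0 : ℝ) 1)).prod
        ((volume : Measure (Fin 2 → ℝ)).restrict (unitCube 2))) := by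
      have h1 : IsFiniteMeasure (volume.restrict (Set.uIoc (0 : ℝ) 1)) :=
        ⟨by simp⟩
      have h2 : IsFiniteMeasure ((volume : Measure (Fin 2 → ℝ)).restrict (unitCube 2)) :=
        ⟨by simp [volume_unitCube]⟩
      infer_instance
    refine Integrable.of_bound (C := 2 * (‖intVec 2 κ‖ * C))
      (hcont.comp continuous_swap).aestronglyMeasurable (ae_of_all _ fun p => ?_)
    refine (abs_dotProduct_le _ _).trans ?_
    gcongr
    exact hC _

end IsStream

/-- The flows of `R⊥∇u` and of the transverse vector field `∇u / |∇u|²`. -/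
structure StreamFlow (u : (Fin 2 → ℝ) → ℝ) where
  /-- The flow of `R⊥∇u`. -/
  Z : ℝ → (Fin 2 → ℝ) → (Fin 2 → ℝ)
  /-- The flow of `∇u / |∇u|²`. -/
  W : ℝ → (Fin 2 → ℝ) → (Fin 2 → ℝ)
  /-- A Lipschitz constant of `R⊥∇u`. -/
  KZ : NNReal
  /-- A Lipschitz constant of `∇u / |∇u|²`. -/
  KW : NNReal
  /-- A bound of `R⊥∇u`. -/
  CZ : ℝ
  /-- A bound of `∇u / |∇u|²`. -/
  CW : ℝ
  isStream : IsStream u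
  flowZ : IsFlowOf (fun y => Rperp (grad u y)) Z
  flowW : IsFlowOf (fun y => (grad u y ⬝ᵥ grad u y)⁻¹ • grad u y) W
  lipZ : LipschitzWith KZ fun y => Rperp (grad u y)
  lipW : LipschitzWith KW fun y => (grad u y ⬝ᵥ grad u y)⁻¹ • grad u y
  boundZ : ∀ y, ‖Rperp (grad u y)‖ ≤ CZ
  boundW : ∀ y, ‖(grad u y ⬝ᵥ grad u y)⁻¹ • grad u y‖ ≤ CW

theorem IsStream.nonempty_streamFlow {u : (Fin 2 → ℝ) → ℝ} (hu : IsStream u) :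
    Nonempty (StreamFlow u) := by
  obtain ⟨CW, KW, W, hCW, hKW, hbW, hW⟩ := hu.exists_flow_grad_div
  obtain ⟨CZ, hCZ⟩ := hu.periodic_Rperp.bounded hu.contDiff_Rperp.continuous
  obtain ⟨KZ, hKZ⟩ := hu.periodic_Rperp.lipschitz hu.contDiff_Rperp
  obtain ⟨Z, hZ⟩ := exists_isFlowOf hKZ hCZ
  exact ⟨⟨Z, W, KZ, KW, CZ, CW, hu, hZ, hW, hKZ, hKW, hCZ, hbW⟩⟩

namespace StreamFlow

variable {u : (Fin 2 → ℝ) → ℝ} (S : StreamFlow u)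

theorem apply_Z (t : ℝ) (x : Fin 2 → ℝ) : u (S.Z t x) = u x := S.isStream.apply_flow S.flowZ t x

theorem apply_W (s : ℝ) (x : Fin 2 → ℝ) : u (S.W s x) = u x + s :=
  S.isStream.apply_transverse S.flowW s x

theorem Z_add (s t : ℝ) (x : Fin 2 → ℝ) : S.Z (s + t) x = S.Z s (S.Z t x) :=
  S.flowZ.add_apply S.lipZ s t x

theorem Z_zero (x : Fin 2 → ℝ) : S.Z 0 x = x := (S.flowZ x).1

theorem transport (δ t : ℝ) (p : Fin 2 → ℝ) : ∃ t', S.W δ (S.Z t p) = S.Z t' (S.W δ p) := by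
  obtain ⟨r, hr, hbox⟩ := S.isStream.exists_flow_eq S.flowZ
  have hlc : IsLocallyConstant fun s : ℝ => ∃ t', S.W δ (S.Z s p) = S.Z t' (S.W δ p) := by
    rw [IsLocallyConstant.iff_eventually_eq]
    intro s
    have hc : ContinuousAt (fun s => S.W δ (S.Z s p)) s :=
      ((S.flowW.continuous_space S.lipW δ).comp (S.flowZ.continuous_time p)).continuousAt
    filter_upwards [hc (Metric.closedBall_mem_nhds _ hr)] with s' hs'
    have hd : ‖S.W δ (S.Z s' p) - S.W δ (S.Z s p)‖ ≤ r := by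
      simpa [dist_eq_norm] using hs'
    obtain ⟨t₁, ht₁⟩ := hbox (S.W δ (S.Z s p)) (S.W δ (S.Z s' p)) hd (by
      rw [S.apply_W, S.apply_W, S.apply_Z, S.apply_Z])
    refine propext ⟨?_, ?_⟩
    · rintro ⟨t', ht'⟩
      refine ⟨-t₁ + t', ?_⟩
      rw [S.Z_add, ← ht', ht₁, ← S.Z_add, neg_add_cancel, S.Z_zero]
    · rintro ⟨t', ht'⟩
      exact ⟨t₁ + t', by rw [S.Z_add, ← ht', ht₁]⟩
  have := hlc.apply_eq_of_preconnectedSpace t 0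
  rw [this]
  exact ⟨0, by rw [S.Z_zero, S.Z_zero]⟩

/-- A section of `u`: a curve along which `u` is the identity. -/
def sec (s : ℝ) : Fin 2 → ℝ := S.W (s - u 0) 0

theorem apply_sec (s : ℝ) : u (S.sec s) = s := by
  rw [sec, S.apply_W]
  ring

theorem continuous_sec : Continuous S.sec :=
  (S.flowW.continuous_time 0).comp (continuous_id.sub continuous_const)

theorem exists_eq_Z_sec (y : Fin 2 → ℝ) : ∃ t, y = S.Z t (S.sec (u y)) := by
  obtain ⟨r, hr, hbox⟩ := S.isStream.exists_flow_eq S.flowZ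
  have hstep : ∀ y y', ‖y' - S.W (u y' - u y) y‖ ≤ r → (∃ t, y = S.Z t (S.sec (u y))) →
      ∃ t, y' = S.Z t (S.sec (u y')) := by
    rintro y y' hyy' ⟨t, ht⟩
    obtain ⟨t₁, ht₁⟩ := hbox (S.W (u y' - u y) y) y' hyy' (by
      rw [S.apply_W]; ring)
    obtain ⟨t₂, ht₂⟩ := S.transport (u y' - u y) t (S.sec (u y))
    rw [← ht, sec, ← S.flowW.add_apply S.lipW, sub_add_sub_cancel] at ht₂
    exact ⟨t₁ + t₂, by rw [S.Z_add, sec, ← ht₂, ← ht₁]⟩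
  have hucont : Continuous u := S.isStream.contDiff.continuous
  have hCW : 0 ≤ S.CW := (norm_nonneg _).trans (S.boundW 0)
  have hlc : IsLocallyConstant fun y => ∃ t, y = S.Z t (S.sec (u y)) := by
    rw [IsLocallyConstant.iff_eventually_eq]
    intro y
    have hlim : Tendsto (fun y' => ‖y' - y‖ + S.CW * |u y' - u y|) (nhds y) (nhds 0) := by
      have : Continuous fun y' => ‖y' - y‖ + S.CW * |u y' - u y| := by fun_prop
      simpa using this.tendsto y
    filter_upwards [hlim.eventually (ge_mem_nhds hr)] with y' hy'
    refine propext ⟨hstep y' y ?_, hstep y y' ?_⟩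
    · have h1 := S.flowW.norm_sub_le S.boundW (u y - u y') y'
      calc ‖y - S.W (u y - u y') y'‖ = ‖(y' - y) + (S.W (u y - u y') y' - y')‖ := by
            rw [norm_sub_rev]; congr 1; abel
        _ ≤ ‖y' - y‖ + S.CW * |u y' - u y| := by
            rw [abs_sub_comm (u y')]
            exact (norm_add_le _ _).trans (by gcongr)
        _ ≤ r := hy'
    · have h1 := S.flowW.norm_sub_le S.boundW (u y' - u y) y
      calc ‖y' - S.W (u y' - u y) y‖ = ‖(y' - y) - (S.W (u y' - u y) y - y)‖ := by
            congr 1; abel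
        _ ≤ ‖y' - y‖ + S.CW * |u y' - u y| := (norm_sub_le _ _).trans (by gcongr)
        _ ≤ r := hy'
  have := hlc.apply_eq_of_preconnectedSpace y 0
  rw [this]
  refine ⟨0, ?_⟩
  rw [S.Z_zero, sec, sub_self, (S.flowW 0).1]

/-- There are no periodic trajectories. -/
theorem eq_zero_of_Z_eq {t : ℝ} {p : Fin 2 → ℝ} (h : S.Z t p = p) : t = 0 := by
  by_contra ht
  obtain ⟨T, hT, hTp⟩ : ∃ T > 0, S.Z T p = p := by
    rcases lt_or_gt_of_ne ht with h0 | h0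
    · refine ⟨-t, by linarith, ?_⟩
      conv_lhs => rw [← h]
      rw [← S.Z_add, neg_add_cancel, S.Z_zero]
    · exact ⟨t, h0, h⟩
  have hper : Function.Periodic (fun s => S.Z s p) T := fun s => by
    change S.Z (s + T) p = S.Z s p
    rw [S.Z_add, hTp]
  obtain ⟨R, hR⟩ := (isCompact_Icc (a := (0 : ℝ)) (b := T)).exists_bound_of_continuousOn
    (S.flowZ.continuous_time p).continuousOn
  have hRall : ∀ q, u q = u p → ‖q‖ ≤ R := by
    intro q hq
    obtain ⟨t₁, ht₁⟩ := S.exists_eq_Z_sec q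
    obtain ⟨t₂, ht₂⟩ := S.exists_eq_Z_sec p
    have h1 : q = S.Z (t₁ - t₂) p := by
      conv_rhs => rw [ht₂]
      rw [← S.Z_add, sub_add_cancel, ← hq, ← ht₁]
    obtain ⟨s, hs, hs'⟩ := hper.exists_mem_Ico₀ hT (t₁ - t₂)
    change S.Z (t₁ - t₂) p = S.Z s p at hs'
    rw [h1, hs']
    exact hR s ⟨hs.1, hs.2.le⟩
  set ξ := ∫ y in unitCube 2, grad u y with hξ
  have hα : ξ 0 ≠ 0 := by
    have := S.isStream.ergodic ![1, 0] (by simp)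
    simpa [dotProduct, Fin.sum_univ_two] using this
  have hCW : 0 ≤ S.CW := (norm_nonneg _).trans (S.boundW 0)
  have hn : ∀ n : ℕ, (n : ℝ) ≤ R + S.CW * |ξ 0| + ‖p‖ := by
    intro n
    set κ : Fin 2 → ℤ := ![⌊-(n * ξ 1 / ξ 0)⌋, n] with hκ
    have hdot : |ξ ⬝ᵥ intVec 2 κ| ≤ |ξ 0| := by
      have h1 : ξ ⬝ᵥ intVec 2 κ = -(ξ 0 * Int.fract (-(n * ξ 1 / ξ 0))) := by
        simp only [dotProduct, Fin.sum_univ_two, intVec_apply, hκ, cons_val_zero, cons_val_one,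
          Int.cast_natCast, ← Int.self_sub_floor]
        field_simp
        ring
      rw [h1, abs_neg, abs_mul, abs_of_nonneg (Int.fract_nonneg (-(n * ξ 1 / ξ 0)))]
      exact mul_le_of_le_one_right (abs_nonneg _) (Int.fract_lt_one _).le
    have h2 := hRall (S.W (-(ξ ⬝ᵥ intVec 2 κ)) (p + intVec 2 κ)) (by
      rw [S.apply_W, S.isStream.apply_add_intVec]; ring)
    have h3 := S.flowW.norm_sub_le S.boundW (-(ξ ⬝ᵥ intVec 2 κ)) (p + intVec 2 κ)
    rw [abs_neg] at h3
    have h4 : (n : ℝ) ≤ ‖intVec 2 κ‖ := by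
      have := norm_le_pi_norm (intVec 2 κ) 1
      simpa [hκ] using this
    set q := S.W (-(ξ ⬝ᵥ intVec 2 κ)) (p + intVec 2 κ)
    calc (n : ℝ) ≤ ‖intVec 2 κ‖ := h4
      _ = ‖q - (q - (p + intVec 2 κ)) - p‖ := by congr 1; abel
      _ ≤ ‖q‖ + ‖q - (p + intVec 2 κ)‖ + ‖p‖ :=
        (norm_sub_le _ _).trans (by gcongr; exact norm_sub_le _ _)
      _ ≤ R + S.CW * |ξ 0| + ‖p‖ := by
        have := mul_le_mul_of_nonneg_left hdot hCW
        linarith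
  obtain ⟨n, hn'⟩ := exists_nat_gt (R + S.CW * |ξ 0| + ‖p‖)
  exact absurd (hn n) (not_le.2 hn')

/-- The coordinates of the plane given by the value of `u` and the time along trajectories. -/
def coord (p : ℝ × ℝ) : Fin 2 → ℝ := S.Z p.2 (S.sec p.1)

theorem continuous_coord : Continuous S.coord :=
  (S.flowZ.continuous_uncurry S.lipZ S.boundZ).comp
    (continuous_snd.prodMk (S.continuous_sec.comp continuous_fst))

theorem apply_coord (p : ℝ × ℝ) : u (S.coord p) = p.1 := by
  rw [coord, S.apply_Z, S.apply_sec]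

theorem bijective_coord : Function.Bijective S.coord := by
  refine ⟨?_, fun y => ?_⟩
  · rintro ⟨s, t⟩ ⟨s', t'⟩ h
    have hs : s = s' := by simpa only [apply_coord] using congrArg u h
    subst hs
    have h1 : S.Z (t - t') (S.sec s) = S.sec s := by
      have := congrArg (S.Z (-t')) h
      simp only [coord] at this
      rw [← S.Z_add, ← S.Z_add, neg_add_cancel, S.Z_zero, neg_add_eq_sub] at this
      exact this
    rw [sub_eq_zero.1 (S.eq_zero_of_Z_eq h1)]
  · obtain ⟨t, ht⟩ := S.exists_eq_Z_sec y
    exact ⟨(u y, t), ht.symm⟩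

theorem measurableEmbedding_coord : MeasurableEmbedding S.coord :=
  S.continuous_coord.measurableEmbedding S.bijective_coord.1

/-- `coord` as a measurable equivalence. -/
def coordEquiv : (ℝ × ℝ) ≃ᵐ (Fin 2 → ℝ) where
  toEquiv := Equiv.ofBijective S.coord S.bijective_coord
  measurable_toFun := S.continuous_coord.measurable
  measurable_invFun := fun s hs => by
    rw [← Equiv.image_eq_preimage_symm]
    exact S.measurableEmbedding_coord.measurableSet_image.2 hs

theorem Z_coord (τ : ℝ) (p : ℝ × ℝ) : S.Z τ (S.coord p) = S.coord (p.1, p.2 + τ) := by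
  rw [coord, coord, ← S.Z_add, add_comm]

/-- The time shift produced by an integer translation in the coordinates `coord`. -/
def shift (κ : Fin 2 → ℤ) (s : ℝ) : ℝ := (S.coordEquiv.symm (S.sec s + intVec 2 κ)).2

theorem measurable_shift (κ : Fin 2 → ℤ) : Measurable (S.shift κ) :=
  measurable_snd.comp (S.coordEquiv.symm.measurable.comp
    (S.continuous_sec.measurable.add_const _))

theorem coord_add_intVec (κ : Fin 2 → ℤ) (p : ℝ × ℝ) :
    S.coord p + intVec 2 κ =
      S.coord (p.1 + (∫ y in unitCube 2, grad u y) ⬝ᵥ intVec 2 κ, p.2 + S.shift κ p.1) := by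
  obtain ⟨s, t⟩ := p
  have h1 : S.coord (S.coordEquiv.symm (S.sec s + intVec 2 κ)) = S.sec s + intVec 2 κ :=
    S.coordEquiv.apply_symm_apply _
  have h2 : (S.coordEquiv.symm (S.sec s + intVec 2 κ)).1 =
      s + (∫ y in unitCube 2, grad u y) ⬝ᵥ intVec 2 κ := by
    rw [← S.apply_coord, h1, S.isStream.apply_add_intVec, S.apply_sec]
  have h3 := S.flowZ.equivariant S.lipZ S.isStream.periodic_Rperp κ t (S.sec s)
  change S.Z t (S.sec s) + intVec 2 κ = _
  refine h3.symm.trans ?_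
  change S.Z t (S.sec s + intVec 2 κ) = _
  rw [← h1, S.Z_coord, h2, shift, add_comm t]

end StreamFlow

namespace MeasureTheory.Measure

/-- A locally finite measure on `ℝ × ℝ` which is invariant under the translations of the second
coordinate is the product of a measure and Lebesgue measure. -/
theorem eq_prod_volume_of_map_add_snd {N : Measure (ℝ × ℝ)} [IsFiniteMeasureOnCompacts N]
    (hN : ∀ τ : ℝ, N.map (fun p => (p.1, p.2 + τ)) = N) :
    IsLocallyFiniteMeasure ((N.restrict (Prod.snd ⁻¹' Set.Ico 0 1)).map Prod.fst) ∧
      N = ((N.restrict (Prod.snd ⁻¹' Set.Ico 0 1)).map Prod.fst).prod volume := by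
  set L := (N.restrict (Prod.snd ⁻¹' Set.Ico (0 : ℝ) 1)).map Prod.fst with hL
  have hLA : ∀ A, MeasurableSet A → L A = N (A ×ˢ Set.Ico 0 1) := fun A hA => by
    rw [hL, map_apply measurable_fst hA, restrict_apply (measurable_fst hA), Set.prod_eq]
  have hlt : ∀ A B : Set ℝ, Bornology.IsBounded A → Bornology.IsBounded B → N (A ×ˢ B) < ⊤ :=
    fun A B hA hB => (hA.prod hB).measure_lt_top
  have hloc : IsLocallyFiniteMeasure L := ⟨fun x => ⟨Metric.ball x 1, Metric.ball_mem_nhds x one_pos,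
    by
      rw [hLA _ Metric.isOpen_ball.measurableSet]
      exact hlt _ _ Metric.isBounded_ball (Metric.isBounded_Ico 0 1)⟩⟩
  refine ⟨hloc, ?_⟩
  have hbdd : ∀ A B : Set ℝ, MeasurableSet A → MeasurableSet B → Bornology.IsBounded A →
      N (A ×ˢ B) = L A * volume B := by
    intro A B hA hB hAb
    set ν := (N.restrict (Prod.fst ⁻¹' A)).map Prod.snd with hν
    have hνB : ∀ B, MeasurableSet B → ν B = N (A ×ˢ B) := fun B hB => by
      rw [hν, map_apply measurable_snd hB, restrict_apply (measurable_snd hB), Set.prod_eq,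
        Set.inter_comm]
    have : IsFiniteMeasureOnCompacts ν := ⟨fun K hK => by
      rw [hνB _ hK.measurableSet]
      exact hlt _ _ hAb hK.isBounded⟩
    have : IsAddLeftInvariant ν := ⟨fun τ => by
      ext B hB
      rw [map_apply (measurable_const_add τ) hB, hνB _ (measurable_const_add τ hB), hνB _ hB]
      conv_rhs => rw [← hN τ]
      rw [map_apply (by fun_prop) (hA.prod hB)]
      congr 1
      ext p
      simp [add_comm]⟩
    obtain ⟨c, h1⟩ : ∃ c : NNReal, ν = c • volume := ⟨_, isAddLeftInvariant_eq_smul ν volume⟩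
    have h2 : L A = c := by
      rw [hLA _ hA, ← hνB _ measurableSet_Ico, h1]
      simp
    rw [← hνB _ hB, h2, h1]
    rfl
  symm
  refine prod_eq fun A B hA hB => ?_
  set An : ℕ → Set ℝ := fun n => A ∩ Metric.ball 0 n with hAn
  have hmono : Monotone An := fun n k hnk =>
    Set.inter_subset_inter_right _ (Metric.ball_subset_ball (by exact_mod_cast hnk))
  have hU : A = ⋃ n, An n := by
    rw [← Set.inter_iUnion, Metric.iUnion_ball_nat, Set.inter_univ]
  have hmB : Monotone fun n => An n ×ˢ B := fun n k hnk => Set.prod_mono_left (hmono hnk)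
  rw [hU, Set.iUnion_prod_const, hmB.measure_iUnion, hmono.measure_iUnion, ENNReal.iSup_mul]
  exact iSup_congr fun n => hbdd _ _ (hA.inter Metric.isOpen_ball.measurableSet) hB
    (Metric.isBounded_ball.subset Set.inter_subset_right)

/-- A locally finite measure on `ℝ` invariant under a dense set of translations is a multiple of
Lebesgue measure. -/
theorem exists_eq_smul_volume_of_dense {L : Measure ℝ} [IsLocallyFiniteMeasure L] {G : Set ℝ}
    (hG : Dense G) (hL : ∀ δ ∈ G, L.map (· + δ) = L) : ∃ c : NNReal, L = c • volume := by
  have hle : ∀ a b x : ℝ, L (Set.Ioo a b) ≤ L (Set.Ioo (a + x) (b + x)) := by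
    intro a b x
    set I : ℕ → Set ℝ := fun n => Set.Ioo (a + 1 / ((n : ℝ) + 1)) (b - 1 / ((n : ℝ) + 1)) with hI
    have hmono : Monotone I := fun n k hnk => by
      have := Nat.one_div_le_one_div (α := ℝ) hnk
      exact Set.Ioo_subset_Ioo (by linarith) (by linarith)
    have hU : Set.Ioo a b = ⋃ n, I n := by
      ext y
      simp only [Set.mem_iUnion, hI, Set.mem_Ioo]
      constructor
      · rintro ⟨h1, h2⟩
        obtain ⟨n, hn⟩ := exists_nat_one_div_lt (lt_min (sub_pos.2 h1) (sub_pos.2 h2))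
        have := lt_min_iff.1 hn
        exact ⟨n, by linarith, by linarith⟩
      · rintro ⟨n, h1, h2⟩
        have : (0 : ℝ) < 1 / ((n : ℝ) + 1) := Nat.one_div_pos_of_nat
        exact ⟨by linarith, by linarith⟩
    rw [hU, hmono.measure_iUnion]
    refine iSup_le fun n => ?_
    have hε : (0 : ℝ) < 1 / ((n : ℝ) + 1) := Nat.one_div_pos_of_nat
    obtain ⟨δ, hδG, hδ⟩ := hG.exists_dist_lt x hε
    rw [Real.dist_eq, abs_lt] at hδ
    conv_rhs => rw [← hL δ hδG]
    rw [map_apply (measurable_add_const δ) measurableSet_Ioo]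
    refine measure_mono fun y hy => ?_
    simp only [hI, Set.mem_preimage, Set.mem_Ioo] at hy ⊢
    constructor <;> linarith
  have hinv : IsAddLeftInvariant L := ⟨fun x => by
    have : IsFiniteMeasureOnCompacts (L.map (x + ·)) :=
      IsFiniteMeasureOnCompacts.map L (Homeomorph.addLeft x)
    refine Real.measure_ext_Ioo_rat fun a b => ?_
    rw [map_apply (measurable_const_add x) measurableSet_Ioo, Set.preimage_const_add_Ioo]
    refine le_antisymm ?_ ?_
    · simpa using hle (a - x) (b - x) x
    · simpa [sub_eq_add_neg] using hle a b (-x)⟩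
  exact ⟨_, isAddLeftInvariant_eq_smul L volume⟩

end MeasureTheory.Measure

theorem IsStream.dense_range_dotProduct {u : (Fin 2 → ℝ) → ℝ} (hu : IsStream u) :
    Dense (Set.range fun κ : Fin 2 → ℤ => (∫ y in unitCube 2, grad u y) ⬝ᵥ intVec 2 κ) := by
  set ξ := ∫ y in unitCube 2, grad u y with hξ
  have herg : ∀ κ : Fin 2 → ℤ, κ ≠ 0 → ξ ⬝ᵥ intVec 2 κ ≠ 0 := hu.ergodic
  let φ : (Fin 2 → ℤ) →+ ℝ :=
    { toFun := fun κ => ξ ⬝ᵥ intVec 2 κ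
      map_zero' := by simp
      map_add' := fun κ κ' => by rw [map_add, dotProduct_add] }
  rcases φ.range.dense_or_cyclic with h | ⟨α, hα⟩
  · exact h
  · exfalso
    have hmem : ∀ κ, ∃ n : ℤ, n • α = ξ ⬝ᵥ intVec 2 κ := fun κ => by
      have : φ κ ∈ AddSubgroup.closure {α} := hα ▸ ⟨κ, rfl⟩
      exact AddSubgroup.mem_closure_singleton.1 this
    obtain ⟨p, hp⟩ := hmem ![1, 0]
    obtain ⟨q, hq⟩ := hmem ![0, 1]
    have h0 := herg ![1, 0] (by simp)
    rw [← hp] at h0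
    have hp0 : p ≠ 0 := by
      rintro rfl
      simp at h0
    refine herg ![q, -p] (by simp [hp0]) ?_
    simp only [dotProduct, Fin.sum_univ_two, intVec_apply, cons_val_zero, cons_val_one,
      Int.cast_one, Int.cast_zero, mul_one, mul_zero, add_zero, zero_add, zsmul_eq_mul,
      Int.cast_neg] at hp hq ⊢
    rw [← hp, ← hq]
    ring

namespace StreamFlow

variable {u : (Fin 2 → ℝ) → ℝ} (S : StreamFlow u)

theorem exists_eq_smul_map_coord {σ : Measure (Fin 2 → ℝ)} [IsFiniteMeasureOnCompacts σ]
    (hσZ : ∀ τ, σ.map (S.Z τ) = σ) (hσ : IntInvariant σ) :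
    ∃ c : NNReal, σ = c • (volume : Measure (ℝ × ℝ)).map S.coord := by
  set N := σ.map S.coordEquiv.symm with hN
  have hσN : σ = N.map S.coord := by
    rw [hN]
    change σ = (σ.map S.coordEquiv.symm).map S.coordEquiv
    rw [MeasurableEquiv.map_map_symm]
  have hsymm : ∀ x, S.coord (S.coordEquiv.symm x) = x := S.coordEquiv.apply_symm_apply
  have hsymm' : ∀ p, S.coordEquiv.symm (S.coord p) = p := S.coordEquiv.symm_apply_apply
  have hfin : IsFiniteMeasureOnCompacts N := ⟨fun K hK => by
    rw [hN, MeasurableEquiv.map_apply, ← MeasurableEquiv.image_eq_preimage_symm]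
    exact (hK.image S.continuous_coord).measure_lt_top⟩
  have htrans : ∀ (T : (Fin 2 → ℝ) → (Fin 2 → ℝ)) (T' : ℝ × ℝ → ℝ × ℝ), Measurable T →
      Measurable T' → σ.map T = σ → (∀ p, T (S.coord p) = S.coord (T' p)) → N.map T' = N := by
    intro T T' hT hT' hσT h
    have h1 : S.coordEquiv.symm ∘ T = T' ∘ S.coordEquiv.symm := by
      ext1 x
      simp only [Function.comp_apply]
      rw [← hsymm' (T' _), ← h, hsymm]
    rw [hN, Measure.map_map hT' S.coordEquiv.symm.measurable, ← h1,
      ← Measure.map_map S.coordEquiv.symm.measurable hT, hσT]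
  obtain ⟨hloc, hprod⟩ := Measure.eq_prod_volume_of_map_add_snd (N := N) fun τ =>
    htrans (S.Z τ) _ (S.flowZ.continuous_space S.lipZ τ).measurable (by fun_prop) (hσZ τ)
      (S.Z_coord τ)
  set L := (N.restrict (Prod.snd ⁻¹' Set.Ico (0 : ℝ) 1)).map Prod.fst with hL
  obtain ⟨c, hc⟩ := Measure.exists_eq_smul_volume_of_dense (L := L)
    S.isStream.dense_range_dotProduct (by
      rintro δ ⟨κ, hδ⟩
      have hcoord : ∀ p, S.coord p + intVec 2 κ = S.coord (p.1 + δ, p.2 + S.shift κ p.1) :=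
        fun p => hδ ▸ S.coord_add_intVec κ p
      ext A hA
      have hTm : Measurable fun p : ℝ × ℝ => (p.1 + δ, p.2 + S.shift κ p.1) :=
        (measurable_fst.add_const _).prodMk
          (measurable_snd.add ((S.measurable_shift κ).comp measurable_fst))
      have h1 := htrans (fun x => x + intVec 2 κ) _ (measurable_add_const _) hTm (hσ κ).map_eq
        hcoord
      have hAI := hA.prod (measurableSet_Ico (a := (0 : ℝ)) (b := 1))
      have h2 : N (A ×ˢ Set.Ico (0 : ℝ) 1) = L A := by
        rw [hprod, Measure.prod_prod]
        simp
      rw [← h2, ← h1, Measure.map_apply hTm hAI, hprod, Measure.prod_apply (hTm hAI),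
        Measure.map_apply (measurable_add_const _) hA,
        ← lintegral_indicator_one (measurable_add_const _ hA)]
      refine lintegral_congr fun s => ?_
      by_cases hs : s + δ ∈ A
      · have h3 : Prod.mk s ⁻¹' ((fun p : ℝ × ℝ => (p.1 + δ, p.2 + S.shift κ p.1)) ⁻¹'
            A ×ˢ Set.Ico (0 : ℝ) 1) = (fun t => t + S.shift κ s) ⁻¹' Set.Ico 0 1 := by
          ext t
          simp only [Set.mem_preimage, Set.mem_prod, hs, true_and]
        rw [h3, measure_preimage_add_right]
        simp [hs]
      · have h3 : Prod.mk s ⁻¹' ((fun p : ℝ × ℝ => (p.1 + δ, p.2 + S.shift κ p.1)) ⁻¹'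
            A ×ˢ Set.Ico (0 : ℝ) 1) = ∅ := by
          ext t
          simp [hs]
        rw [h3]
        simp [hs])
  refine ⟨c, ?_⟩
  rw [hσN, hprod, hc, ← Measure.map_smul, Measure.prod_smul_left]
  rfl

theorem exists_eq_smul_volume {σ : Measure (Fin 2 → ℝ)} [IsFiniteMeasureOnCompacts σ]
    (hσZ : ∀ τ, σ.map (S.Z τ) = σ) (hσ : IntInvariant σ) :
    ∃ c : NNReal, σ = c • volume := by
  obtain ⟨c, hc⟩ := S.exists_eq_smul_map_coord hσZ hσ
  have hvol : ∀ τ, (volume : Measure (Fin 2 → ℝ)).map (S.Z τ) = volume := fun τ => by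
    have hloc : IsLocallyFiniteMeasure ((volume : Measure (Fin 2 → ℝ)).withDensity
        fun y => (ENNReal.ofReal 1)⁻¹) := by
      simpa using (inferInstance : IsLocallyFiniteMeasure (volume : Measure (Fin 2 → ℝ)))
    have h := IsFlowOf.map_withDensity_inv (g := fun _ => 1) S.isStream.contDiff_Rperp S.lipZ
      S.isStream.div_Rperp continuous_const (fun _ => zero_le_one) (Y := S.Z) (K := S.KZ)
      (C := S.CZ) (by simpa using S.flowZ) (by simpa using S.lipZ) (by simpa using S.boundZ) τ
    simpa using h
  obtain ⟨c₀, hc₀⟩ := S.exists_eq_smul_map_coord hvol (intInvariant_volume 2)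
  have hc₀0 : c₀ ≠ 0 := by
    rintro rfl
    rw [zero_smul] at hc₀
    exact (NeZero.ne (volume : Measure (Fin 2 → ℝ))) hc₀
  refine ⟨c * c₀⁻¹, ?_⟩
  rw [hc₀, smul_smul, mul_assoc, inv_mul_cancel₀ hc₀0, mul_one, ← hc]

end StreamFlow

theorem IntInvariant.isLocallyFiniteMeasure {d : ℕ} {M : Measure (Fin d → ℝ)} (hM : IntInvariant M)
    (hQ : M (unitCube d) ≠ ⊤) : IsLocallyFiniteMeasure M := by
  refine ⟨fun x => ⟨Metric.ball x 1, Metric.ball_mem_nhds x one_pos, ?_⟩⟩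
  have hcov : Metric.ball x 1 ⊆ ⋃ κ ∈ {κ : Fin d → ℤ | ‖intVec d κ‖ ≤ ‖x‖ + 2},
      (fun y => y + intVec d κ) ⁻¹' unitCube d := by
    intro y hy
    have hyx : ‖y‖ ≤ ‖x‖ + 1 := by
      rw [mem_ball_iff_norm] at hy
      calc ‖y‖ = ‖x + (y - x)‖ := by congr 1; abel
        _ ≤ ‖x‖ + 1 := (norm_add_le _ _).trans (by linarith)
    have hfr : fractVec y = y + intVec d (fun i => -⌊y i⌋) := by
      ext i
      rw [Pi.add_apply, intVec_apply, fractVec, Int.fract]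
      push_cast
      ring
    simp only [Set.mem_iUnion]
    refine ⟨fun i => -⌊y i⌋, ?_, ?_⟩
    · have h1 : intVec d (fun i => -⌊y i⌋) = fractVec y - y := by rw [hfr]; abel
      rw [Set.mem_ofPred_eq, h1]
      refine (norm_sub_le _ _).trans ?_
      have := norm_le_of_mem_unitCube (fractVec_mem y)
      linarith
    · rw [Set.mem_preimage, ← hfr]
      exact fractVec_mem y
  refine (measure_mono hcov).trans_lt (measure_biUnion_lt_top (finite_norm_intVec_le d _) ?_)
  intro κ _
  rw [(hM κ).measure_preimage (measurableSet_unitCube d).nullMeasurableSet]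
  exact hQ.lt_top

theorem IsFlowOf.eq_of_eq_zero {d : ℕ} {F : (Fin d → ℝ) → (Fin d → ℝ)}
    {Y : ℝ → (Fin d → ℝ) → (Fin d → ℝ)} {K : NNReal} (hY : IsFlowOf F Y)
    (hF : LipschitzWith K F) {x : Fin d → ℝ} (hx : F x = 0) (t : ℝ) : Y t x = x :=
  (hY.eq_of_hasDerivAt hF (γ := fun _ => x)
    (fun t => by rw [hx]; exact hasDerivAt_const t x) t).symm

namespace StreamFlow

variable {u : (Fin 2 → ℝ) → ℝ} (S : StreamFlow u)
  {g : (Fin 2 → ℝ) → ℝ} (hg : ContDiff ℝ 1 g) (hgp : ZdPeriodic g) (hg0 : ∀ x, 0 ≤ g x)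
  {X : ℝ → (Fin 2 → ℝ) → (Fin 2 → ℝ)} (hX : IsFlowOf (fun y => g y • Rperp (grad u y)) X)

include S hg hgp in
theorem contDiff_periodic_smul : ContDiff ℝ 1 (fun y => g y • Rperp (grad u y)) ∧
    ZdPeriodic (fun y => g y • Rperp (grad u y)) := by
  refine ⟨hg.smul S.isStream.contDiff_Rperp, fun κ x => ?_⟩
  have := S.isStream.periodic_Rperp κ x
  simp only at this ⊢
  rw [hgp, this]

include S hg hgp hg0 hX in
theorem exists_withDensity_eq_smul {μ : Measure (Fin 2 → ℝ)} [IsProbabilityMeasure μ]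
    (hμ : μ (unitCube 2)ᶜ = 0) (hinv : FlowInvariant X μ) :
    ∃ c : NNReal, μ.withDensity (fun y => ENNReal.ofReal (g y)) =
      c • volume.restrict (unitCube 2) := by
  obtain ⟨hF, hFp⟩ := S.contDiff_periodic_smul hg hgp
  obtain ⟨K, hK⟩ := hFp.lipschitz hF
  obtain ⟨C, hC⟩ := hFp.bounded hF.continuous
  have hM := hX.map_unfoldMeasure hK hFp hμ hinv
  have hloc := isLocallyFiniteMeasure_unfoldMeasure hμ
  have hloc' : IsLocallyFiniteMeasure
      ((unfoldMeasure μ).withDensity fun y => ENNReal.ofReal (g y)) :=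
    IsLocallyFiniteMeasure.withDensity_ofReal hg.continuous
  have hZ := S.flowZ.map_withDensity_of_invariant S.lipZ S.boundZ hg.continuous hg0 hX hK hC hM
  obtain ⟨c, hc⟩ := S.exists_eq_smul_volume hZ
    (intInvariant_unfoldMeasure.withDensity (fun κ x => by rw [hgp])
      hg.continuous.measurable.ennreal_ofReal)
  refine ⟨c, ?_⟩
  rw [← Measure.restrict_smul, ← hc, restrict_withDensity (measurableSet_unitCube 2),
    unfoldMeasure_restrict hμ]

include S hg hgp hg0 hX in
theorem exists_integral_eq_smul {μ : Measure (Fin 2 → ℝ)} [IsProbabilityMeasure μ]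
    (hμ : μ (unitCube 2)ᶜ = 0) (hinv : FlowInvariant X μ) :
    ∃ c : NNReal, ∫ y, g y • Rperp (grad u y) ∂μ =
        (c : ℝ) • ∫ y in unitCube 2, Rperp (grad u y) ∧
      (c : ENNReal) * ∫⁻ y in unitCube 2, (ENNReal.ofReal (g y))⁻¹ ≤ 1 ∧
      ((∀ y, 0 < g y) → (c : ENNReal) * ∫⁻ y in unitCube 2, (ENNReal.ofReal (g y))⁻¹ = 1) := by
  obtain ⟨c, hc⟩ := S.exists_withDensity_eq_smul hg hgp hg0 hX hμ hinv
  have hgm : Measurable fun y => ENNReal.ofReal (g y) := hg.continuous.measurable.ennreal_ofReal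
  have h1 : (c : ENNReal) * ∫⁻ y in unitCube 2, (ENNReal.ofReal (g y))⁻¹ =
      ∫⁻ y, ENNReal.ofReal (g y) * (ENNReal.ofReal (g y))⁻¹ ∂μ := by
    refine Eq.trans ?_ (lintegral_withDensity_eq_lintegral_mul μ hgm hgm.inv)
    rw [hc, lintegral_smul_measure]
    rfl
  refine ⟨c, ?_, ?_, fun hpos => ?_⟩
  · have h2 := integral_withDensity_eq_integral_toReal_smul (μ := μ) hgm
      (ae_of_all _ fun y => ENNReal.ofReal_lt_top) (fun y => Rperp (grad u y))
    rw [hc, integral_smul_nnreal_measure] at h2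
    simp_rw [ENNReal.toReal_ofReal (hg0 _)] at h2
    exact h2.symm
  · rw [h1]
    calc _ ≤ ∫⁻ _, 1 ∂μ := lintegral_mono fun y => ENNReal.mul_inv_le_one _
      _ = 1 := by simp
  · rw [h1]
    calc _ = ∫⁻ _, 1 ∂μ := lintegral_congr fun y =>
          ENNReal.mul_inv_cancel (by simpa using hpos y) ENNReal.ofReal_ne_top
      _ = 1 := by simp

include S hg hgp hg0 hX in
theorem smul_mem_rotationSet (hI : ∫⁻ y in unitCube 2, (ENNReal.ofReal (g y))⁻¹ ≠ ⊤)
    (hI0 : ∫⁻ y in unitCube 2, (ENNReal.ofReal (g y))⁻¹ ≠ 0) {p : Fin 2 → ℝ} (hp : g p = 0)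
    {s : ℝ} (hs0 : 0 ≤ s) (hs1 : s ≤ 1) :
    s • (((∫⁻ y in unitCube 2, (ENNReal.ofReal (g y))⁻¹).toReal)⁻¹ •
      ∫ y in unitCube 2, Rperp (grad u y)) ∈
        rotationSet (fun y => g y • Rperp (grad u y)) X := by
  obtain ⟨hF, hFp⟩ := S.contDiff_periodic_smul hg hgp
  obtain ⟨K, hK⟩ := hFp.lipschitz hF
  obtain ⟨C, hC⟩ := hFp.bounded hF.continuous
  set w : (Fin 2 → ℝ) → ENNReal := fun y => (ENNReal.ofReal (g y))⁻¹ with hw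
  set I := ∫⁻ y in unitCube 2, w y with hIdef
  have hwm : Measurable w := hg.continuous.measurable.ennreal_ofReal.inv
  set M := (volume : Measure (Fin 2 → ℝ)).withDensity w with hM
  have hMint : IntInvariant M :=
    (intInvariant_volume 2).withDensity (fun κ x => by simp only [hw]; rw [hgp]) hwm
  have hMQ : M (unitCube 2) = I := withDensity_apply _ (measurableSet_unitCube 2)
  have hMloc : IsLocallyFiniteMeasure M := hMint.isLocallyFiniteMeasure (hMQ ▸ hI)
  have hMX : ∀ t, M.map (X t) = M := IsFlowOf.map_withDensity_inv S.isStream.contDiff_Rperp S.lipZ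
    S.isStream.div_Rperp hg.continuous hg0 hX hK hC
  have hfinQ : IsFiniteMeasure (M.restrict (unitCube 2)) := ⟨by simpa [hMQ] using hI.lt_top⟩
  set q := fractVec p with hq
  have hq0 : g q = 0 := by rw [hq, hgp.apply_fractVec, hp]
  have hXq : ∀ t, X t q = q := hX.eq_of_eq_zero hK (by rw [hq0, zero_smul])
  set α : NNReal := (s / I.toReal).toNNReal with hα
  set β : NNReal := (1 - s).toNNReal with hβ
  have hα' : (α : ℝ) = s / I.toReal := Real.coe_toNNReal _ (by positivity)
  have hβ' : (β : ℝ) = 1 - s := Real.coe_toNNReal _ (by linarith)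
  have hIpos : 0 < I.toReal := ENNReal.toReal_pos hI0 hI
  have hInt : ∀ {E : Type} [NormedAddCommGroup E] [NormedSpace ℝ E] [CompleteSpace E]
      (f : (Fin 2 → ℝ) → E), AEStronglyMeasurable f (M.restrict (unitCube 2)) →
      (∃ C, ∀ y, ‖f y‖ ≤ C) →
      ∫ y, f y ∂(α • M.restrict (unitCube 2) + β • Measure.dirac q) =
        (α : ℝ) • ∫ y in unitCube 2, f y ∂M + (β : ℝ) • f q := by
    intro E _ _ _ f hf ⟨C, hC⟩
    rw [integral_add_measure, integral_smul_nnreal_measure, integral_smul_nnreal_measure,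
      integral_dirac]
    · rfl
    · exact (Integrable.of_bound hf C (ae_of_all _ hC)).smul_measure_nnreal
    · exact (integrable_dirac (by simp)).smul_measure_nnreal
  refine ⟨α • M.restrict (unitCube 2) + β • Measure.dirac q, ⟨?_⟩, ?_, ?_, ?_⟩
  · have h1 : (α • M.restrict (unitCube 2) + β • Measure.dirac q) Set.univ =
        (α : ENNReal) * I + β := by
      rw [Measure.add_apply, Measure.smul_apply, Measure.smul_apply, Measure.restrict_apply_univ,
        hMQ, measure_univ, ENNReal.smul_def, ENNReal.smul_def, smul_eq_mul, smul_eq_mul, mul_one]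
    rw [h1, ← ENNReal.coe_toNNReal hI]
    norm_cast
    refine NNReal.eq ?_
    push_cast
    rw [hα', hβ', div_mul_cancel₀ _ hIpos.ne']
    ring
  · have : Measure.dirac q (unitCube 2)ᶜ = 0 := by
      rw [Measure.dirac_apply' _ (measurableSet_unitCube 2).compl]
      simp [hq, fractVec_mem]
    have h2 : (M.restrict (unitCube 2)) (unitCube 2)ᶜ = 0 := by
      rw [Measure.restrict_apply (measurableSet_unitCube 2).compl]
      simp
    simp [this, h2]
  · intro t ψ hψ hψp
    have hb := hψp.bounded hψ
    have hXc := hX.continuous_space hK t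
    rw [hInt ψ hψ.aestronglyMeasurable hb,
      hInt (fun y => ψ (X t y)) (hψ.comp hXc).aestronglyMeasurable
        (hb.imp fun C h y => h _), hXq]
    congr 2
    exact hMint.setIntegral_unitCube_comp (hX.homeomorph hK t)
      ⟨hXc.measurable, hMX t⟩ (fun κ x => hX.equivariant hK hFp κ t x) hψp
  · rw [hInt _ hF.continuous.aestronglyMeasurable ⟨C, hC⟩, hq0, zero_smul, smul_zero, add_zero,
      smul_smul, ← div_eq_mul_inv, hα', hM, restrict_withDensity (measurableSet_unitCube 2),
      integral_withDensity_eq_integral_toReal_smul hwm (ae_lt_top hwm hI)]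
    congr 1
    refine integral_congr_ae ?_
    filter_upwards [ae_lt_top hwm hI] with y hy
    have hgy : g y ≠ 0 := fun h => by simp [hw, h] at hy
    simp only [hw, ENNReal.toReal_inv, ENNReal.toReal_ofReal (hg0 y)]
    rw [smul_smul, inv_mul_cancel₀ hgy, one_smul]

end StreamFlow

theorem IsStream.integral_Rperp_ne_zero {u : (Fin 2 → ℝ) → ℝ} (hu : IsStream u) :
    ∫ y in unitCube 2, Rperp (grad u y) ≠ 0 := by
  obtain ⟨C, hC⟩ := hu.periodic.bounded hu.contDiff_grad.continuous
  have hgint : IntegrableOn (grad u) (unitCube 2) :=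
    Measure.integrableOn_of_bounded (by simp [volume_unitCube])
      hu.contDiff_grad.continuous.aestronglyMeasurable (ae_of_all _ hC)
  have h1 : ∫ y in unitCube 2, Rperp (grad u y) = Rperp (∫ y in unitCube 2, grad u y) :=
    RperpL.integral_comp_comm hgint
  rw [h1]
  intro h
  exact hu.ergodic ![1, 0] (by simp) (by rw [Rperp_eq_zero h, zero_dotProduct])

theorem measurable_fractVec {d : ℕ} : Measurable (fractVec : (Fin d → ℝ) → Fin d → ℝ) :=
  measurable_pi_lambda _ fun i => measurable_fract.comp (measurable_pi_apply i)

theorem unitCube_subset_Icc (d : ℕ) : unitCube d ⊆ Set.Icc 0 1 := fun _ hx =>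
  ⟨fun i => (hx i).1, fun i => (hx i).2.le⟩

/-- The distribution, modulo integer translations, of a curve on the time interval `[0, 1]`. -/
def curveMeasure {d : ℕ} (γ : ℝ → Fin d → ℝ) (hγ : Continuous γ) :
    ProbabilityMeasure (Set.Icc (0 : Fin d → ℝ) 1) :=
  ⟨(volume.restrict (Set.Ioc (0 : ℝ) 1)).map
      fun s => ⟨fractVec (γ s), unitCube_subset_Icc d (fractVec_mem _)⟩,
    have : IsProbabilityMeasure (volume.restrict (Set.Ioc (0 : ℝ) 1)) := ⟨by simp⟩
    Measure.isProbabilityMeasure_map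
      ((measurable_fractVec.comp hγ.measurable).subtype_mk).aemeasurable⟩

theorem integral_curveMeasure {d : ℕ} {γ : ℝ → Fin d → ℝ} (hγ : Continuous γ)
    {ψ : (Fin d → ℝ) → ℝ} (hψ : Continuous ψ) (hψp : ZdPeriodic ψ) :
    ∫ y, ψ y ∂(curveMeasure γ hγ : Measure (Set.Icc (0 : Fin d → ℝ) 1)) =
      ∫ s in (0 : ℝ)..1, ψ (γ s) := by
  rw [intervalIntegral.integral_of_le zero_le_one]
  refine (integral_map ((measurable_fractVec.comp hγ.measurable).subtype_mk).aemeasurable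
    (hψ.comp continuous_subtype_val).aestronglyMeasurable).trans ?_
  refine integral_congr_ae (ae_of_all _ fun s => ?_)
  exact hψp.apply_fractVec (γ s)

/-- Limits of time averages along a trajectory are integrals with respect to an invariant
probability measure. -/
theorem IsFlowOf.exists_tendsto_average {d : ℕ} {F : (Fin d → ℝ) → (Fin d → ℝ)}
    {Y : ℝ → (Fin d → ℝ) → (Fin d → ℝ)} {K : NNReal} (hY : IsFlowOf F Y)
    (hF : LipschitzWith K F) (hp : ZdPeriodic F) (U : Ultrafilter ℝ) (hU : ↑U ≤ (atTop : Filter ℝ))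
    (x : Fin d → ℝ) :
    ∃ μ : Measure (Fin d → ℝ), IsProbabilityMeasure μ ∧ μ (unitCube d)ᶜ = 0 ∧
      FlowInvariant Y μ ∧ ∀ ψ : (Fin d → ℝ) → ℝ, Continuous ψ → ZdPeriodic ψ →
        Tendsto (fun T : ℝ => T⁻¹ * ∫ s in (0 : ℝ)..T, ψ (Y s x)) U (nhds (∫ y, ψ y ∂μ)) := by
  have hγ : ∀ T : ℝ, Continuous fun s => Y (T * s) x := fun T =>
    (hY.continuous_time x).comp (continuous_const.mul continuous_id)
  obtain ⟨ν, -, hν⟩ := isCompact_univ.ultrafilter_le_nhds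
    (U.map fun T => curveMeasure (fun s => Y (T * s) x) (hγ T)) (by simp)
  have hν' : Tendsto (fun T => curveMeasure (fun s => Y (T * s) x) (hγ T)) U (nhds ν) := hν
  rw [ProbabilityMeasure.tendsto_iff_forall_integral_tendsto] at hν'
  have hmf : Measurable fun y : Set.Icc (0 : Fin d → ℝ) 1 => fractVec (y : Fin d → ℝ) :=
    measurable_fractVec.comp measurable_subtype_coe
  have hInt : ∀ ψ : (Fin d → ℝ) → ℝ, Continuous ψ → ZdPeriodic ψ →
      ∫ y, ψ y ∂((ν : Measure (Set.Icc (0 : Fin d → ℝ) 1)).map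
        fun y : Set.Icc (0 : Fin d → ℝ) 1 => fractVec (y : Fin d → ℝ)) =
        ∫ y, ψ y ∂(ν : Measure (Set.Icc (0 : Fin d → ℝ) 1)) := fun ψ hψ hψp => by
    rw [integral_map hmf.aemeasurable hψ.aestronglyMeasurable]
    exact integral_congr_ae (ae_of_all _ fun y => hψp.apply_fractVec y)
  have hlim : ∀ ψ : (Fin d → ℝ) → ℝ, Continuous ψ → ZdPeriodic ψ →
      Tendsto (fun T : ℝ => T⁻¹ * ∫ s in (0 : ℝ)..T, ψ (Y s x)) U
        (nhds (∫ y, ψ y ∂((ν : Measure (Set.Icc (0 : Fin d → ℝ) 1)).map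
        fun y : Set.Icc (0 : Fin d → ℝ) 1 => fractVec (y : Fin d → ℝ)))) := by
    intro ψ hψ hψp
    rw [hInt ψ hψ hψp]
    have h1 := hν' (BoundedContinuousFunction.mkOfCompact
      ⟨fun y : Set.Icc (0 : Fin d → ℝ) 1 => ψ y, hψ.comp continuous_subtype_val⟩)
    refine h1.congr' ?_
    filter_upwards [hU (eventually_gt_atTop 0)] with T hT
    refine (integral_curveMeasure (hγ T) hψ hψp).trans ?_
    rw [intervalIntegral.integral_comp_mul_left (fun s => ψ (Y s x)) hT.ne']
    simp
  refine ⟨_, Measure.isProbabilityMeasure_map hmf.aemeasurable, ?_, fun t ψ hψ hψp => ?_, hlim⟩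
  · rw [Measure.map_apply hmf (measurableSet_unitCube d).compl]
    simp [fractVec_mem, Set.preimage]
  · have hYt := hY.continuous_space hF t
    have hψY : ZdPeriodic fun y => ψ (Y t y) := fun κ y => by
      change ψ (Y t (y + _)) = ψ (Y t y)
      rw [hY.equivariant hF hp, hψp]
    refine tendsto_nhds_unique (hlim _ (hψ.comp hYt) hψY) ?_
    obtain ⟨C, hC⟩ := hψp.bounded hψ
    have hψc : Continuous fun s => ψ (Y s x) := hψ.comp (hY.continuous_time x)
    have hii : ∀ α β, IntervalIntegrable (fun s => ψ (Y s x)) volume α β := fun α β =>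
      hψc.intervalIntegrable α β
    have hdiff : Tendsto (fun T : ℝ => T⁻¹ * ((∫ s in T..T + t, ψ (Y s x)) -
        ∫ s in (0 : ℝ)..t, ψ (Y s x))) U (nhds 0) := by
      have h0 : Tendsto (fun T : ℝ => T⁻¹ * (2 * (C * |t|))) U (nhds 0) := by
        simpa using (tendsto_inv_atTop_zero.mono_left hU).mul_const (2 * (C * |t|))
      refine squeeze_zero_norm' ?_ h0
      filter_upwards [hU (eventually_gt_atTop 0)] with T hT
      have hb : ∀ α, ‖∫ s in α..α + t, ψ (Y s x)‖ ≤ C * |t| := fun α => by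
        simpa using intervalIntegral.norm_integral_le_of_norm_le_const (a := α) (b := α + t)
          fun s _ => hC (Y s x)
      have hb0 := hb 0
      rw [zero_add] at hb0
      rw [norm_mul, Real.norm_of_nonneg (inv_nonneg.2 hT.le)]
      gcongr
      refine (_root_.norm_sub_le _ _).trans ?_
      linarith [hb T]
    have h2 := (hlim ψ hψ hψp).add hdiff
    rw [add_zero] at h2
    refine h2.congr fun T => ?_
    rw [← mul_add]
    congr 1
    have h3 : ∫ s in (0 : ℝ)..T, ψ (Y t (Y s x)) = ∫ s in t..T + t, ψ (Y s x) := by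
      simp_rw [← hY.add_apply hF]
      simpa [add_comm] using intervalIntegral.integral_comp_add_left (fun s => ψ (Y s x)) t
        (a := 0) (b := T)
    rw [h3]
    linarith [intervalIntegral.integral_add_adjacent_intervals (hii 0 T) (hii T (T + t)),
      intervalIntegral.integral_add_adjacent_intervals (hii 0 t) (hii t (T + t))]

/-- Limit points of `Y t x / t` belong to the rotation set. -/
theorem IsFlowOf.exists_mem_rotationSet_tendsto {d : ℕ} {F : (Fin d → ℝ) → (Fin d → ℝ)}
    {Y : ℝ → (Fin d → ℝ) → (Fin d → ℝ)} {K : NNReal} (hY : IsFlowOf F Y)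
    (hF : LipschitzWith K F) (hp : ZdPeriodic F) (U : Ultrafilter ℝ) (hU : ↑U ≤ (atTop : Filter ℝ))
    (x : Fin d → ℝ) :
    ∃ ζ ∈ rotationSet F Y, Tendsto (fun t : ℝ => t⁻¹ • Y t x) U (nhds ζ) := by
  obtain ⟨μ, hμ1, hμ2, hμ3, hμ⟩ := hY.exists_tendsto_average hF hp U hU x
  refine ⟨_, ⟨μ, hμ1, hμ2, hμ3, rfl⟩, tendsto_pi_nhds.2 fun i => ?_⟩
  obtain ⟨C, hC⟩ := hp.bounded hF.continuous
  have hFi : Integrable F μ :=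
    Integrable.of_bound hF.continuous.aestronglyMeasurable C (ae_of_all _ hC)
  have hFc : Continuous fun y => F y i := (continuous_apply i).comp hF.continuous
  rw [eval_integral fun i => Integrable.eval hFi i]
  have h1 := hμ (fun y => F y i) hFc fun κ y => congrFun (hp κ y) i
  have h2 : Tendsto (fun T : ℝ => T⁻¹ * x i) U (nhds 0) := by
    simpa using (tendsto_inv_atTop_zero.mono_left hU).mul_const (x i)
  have h3 := h2.add h1
  rw [zero_add] at h3
  refine h3.congr fun T => ?_
  rw [intervalIntegral.integral_eq_sub_of_hasDerivAt (f := fun s => Y s x i)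
    (fun s _ => hasDerivAt_pi.1 ((hY x).2 s) i)
    ((hFc.comp (hY.continuous_time x)).intervalIntegrable _ _), (hY x).1]
  simp only [Pi.smul_apply, smul_eq_mul]
  ring

theorem IsFlowOf.tendsto_of_rotationSet_subset {d : ℕ} {F : (Fin d → ℝ) → (Fin d → ℝ)}
    {Y : ℝ → (Fin d → ℝ) → (Fin d → ℝ)} {K : NNReal} (hY : IsFlowOf F Y)
    (hF : LipschitzWith K F) (hp : ZdPeriodic F) {ζ : Fin d → ℝ} (hζ : rotationSet F Y ⊆ {ζ})
    (x : Fin d → ℝ) : Tendsto (fun t : ℝ => t⁻¹ • Y t x) atTop (nhds ζ) := by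
  rw [tendsto_iff_ultrafilter]
  intro U hU
  obtain ⟨ζ', hζ', h⟩ := hY.exists_mem_rotationSet_tendsto hF hp U hU x
  rwa [Set.mem_singleton_iff.1 (hζ hζ')] at h

/-- Let `b = ρΦ` in dimension two with `Φ = a R⊥∇u`, `a > 0`, `∇u` nowhere
vanishing satisfying the ergodicity condition, and let `m` be the harmonic mean of `aρ`.
Then: (i) if `ρ > 0` everywhere, `X(t,x)/t → m ∫ R⊥∇u`; (ii) if `ρ` vanishes somewhere and
`m = 0`, `X(t,x)/t → 0`; (iii) if `ρ` vanishes somewhere and `m > 0`, `C_b = [0, m ∫ R⊥∇u]`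
with `m ∫ R⊥∇u ≠ 0`. -/
theorem flow_asymptotics_dimension_two_ergodic
    (ρ : (Fin 2 → ℝ) → ℝ) (hρ : ContDiff ℝ 1 ρ) (hρper : ZdPeriodic ρ)
    (hρ0 : ∀ y, 0 ≤ ρ y) (hρne : ∃ y, ρ y ≠ 0)
    (a : (Fin 2 → ℝ) → ℝ) (ha : ContDiff ℝ 1 a) (haper : ZdPeriodic a) (hapos : ∀ y, 0 < a y)
    (u : (Fin 2 → ℝ) → ℝ) (hu : ContDiff ℝ 2 u)
    (huper : ZdPeriodic fun y => grad u y) (hune : ∀ y, grad u y ≠ 0)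
    (herg : ∀ κ : Fin 2 → ℤ, κ ≠ 0 →
      (∫ y in unitCube 2, grad u y) ⬝ᵥ (fun i => (κ i : ℝ)) ≠ 0)
    (X : ℝ → (Fin 2 → ℝ) → (Fin 2 → ℝ))
    (hX : IsFlowOf (fun y => ρ y • (a y • Rperp (grad u y))) X)
    (m : ℝ)
    (hm : m = ((∫⁻ y in unitCube 2, (ENNReal.ofReal (a y * ρ y))⁻¹).toReal)⁻¹)
    (V : Fin 2 → ℝ) (hV : V = ∫ y in unitCube 2, Rperp (grad u y)) :
    ((∀ y, 0 < ρ y) →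
      ∀ x, Tendsto (fun t : ℝ => t⁻¹ • X t x) atTop (nhds (m • V))) ∧
    (((∃ x₀, ρ x₀ = 0) ∧ m = 0) →
      ∀ x, Tendsto (fun t : ℝ => t⁻¹ • X t x) atTop (nhds 0)) ∧
    (((∃ x₀, ρ x₀ = 0) ∧ 0 < m) →
      rotationSet (fun y => ρ y • (a y • Rperp (grad u y))) X = segment ℝ 0 (m • V) ∧
        m • V ≠ 0) := by
  have hstream : IsStream u := ⟨hu, huper, hune, herg⟩
  obtain ⟨S⟩ := hstream.nonempty_streamFlow
  have hfield : (fun y => ρ y • (a y • Rperp (grad u y))) =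
      fun y => (a y * ρ y) • Rperp (grad u y) :=
    funext fun y => by rw [smul_smul, mul_comm]
  rw [hfield] at hX ⊢
  have hg : ContDiff ℝ 1 fun y => a y * ρ y := ha.mul hρ
  have hgp : ZdPeriodic fun y => a y * ρ y := fun κ y => by
    change a (y + _) * ρ (y + _) = a y * ρ y
    rw [haper κ y, hρper κ y]
  have hg0 : ∀ y, 0 ≤ a y * ρ y := fun y => mul_nonneg (hapos y).le (hρ0 y)
  obtain ⟨hF, hFp⟩ := S.contDiff_periodic_smul hg hgp
  obtain ⟨K, hK⟩ := hFp.lipschitz hF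
  set I := ∫⁻ y in unitCube 2, (ENNReal.ofReal (a y * ρ y))⁻¹ with hI
  have hrot : ∀ ζ ∈ rotationSet (fun y => (a y * ρ y) • Rperp (grad u y)) X,
      ∃ c : NNReal, ζ = (c : ℝ) • V ∧ (c : ENNReal) * I ≤ 1 ∧
        ((∀ y, 0 < a y * ρ y) → (c : ENNReal) * I = 1) := by
    rintro ζ ⟨μ, hμ1, hμ2, hμ3, rfl⟩
    rw [hV]
    exact S.exists_integral_eq_smul hg hgp hg0 hX hμ2 hμ3
  refine ⟨fun hpos => hX.tendsto_of_rotationSet_subset hK hFp fun ζ hζ => ?_,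
    fun ⟨_, hm0⟩ => hX.tendsto_of_rotationSet_subset hK hFp fun ζ hζ => ?_,
    fun ⟨⟨p, hp⟩, hm0⟩ => ?_⟩
  · obtain ⟨c, rfl, -, hc⟩ := hrot ζ hζ
    have hcI := congrArg ENNReal.toReal (hc fun y => mul_pos (hapos y) (hpos y))
    rw [ENNReal.toReal_mul, ENNReal.coe_toReal, ENNReal.toReal_one] at hcI
    rw [hm, eq_inv_of_mul_eq_one_left hcI]
    rfl
  · obtain ⟨c, rfl, hc, -⟩ := hrot ζ hζ
    have hI0 : I ≠ 0 := by
      have hsupp : Function.support (fun y => ENNReal.ofReal (a y * ρ y))⁻¹ = Set.univ :=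
        Set.eq_univ_of_forall fun y => by simp [Function.mem_support]
      refine ((setLIntegral_pos_iff hg.continuous.measurable.ennreal_ofReal.inv).2 ?_).ne'
      rw [hsupp, Set.univ_inter, volume_unitCube]
      exact one_pos
    have hItop : I = ⊤ := by
      rw [hm, inv_eq_zero, ENNReal.toReal_eq_zero_iff] at hm0
      exact hm0.resolve_left hI0
    have hc0 : c = 0 := by
      by_contra h
      rw [hItop, ENNReal.mul_top (by simpa using h)] at hc
      exact absurd hc (by simp)
    simp [hc0]
  · rw [hm, inv_pos, ENNReal.toReal_pos_iff] at hm0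
    have hm1 : 0 < I.toReal := ENNReal.toReal_pos hm0.1.ne' hm0.2.ne
    refine ⟨Set.Subset.antisymm (fun ζ hζ => ?_) ?_, ?_⟩
    · obtain ⟨c, rfl, hc, -⟩ := hrot ζ hζ
      have hcI := ENNReal.toReal_mono ENNReal.one_ne_top hc
      rw [ENNReal.toReal_mul, ENNReal.coe_toReal, ENNReal.toReal_one] at hcI
      rw [segment_eq_image]
      refine ⟨c * I.toReal, ⟨by positivity, hcI⟩, ?_⟩
      simp only [smul_zero, zero_add, smul_smul, hm]
      rw [mul_assoc, mul_inv_cancel₀ hm1.ne', mul_one]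
    · rw [segment_eq_image, hm, hV]
      rintro _ ⟨s, ⟨hs0, hs1⟩, rfl⟩
      simp only [smul_zero, zero_add]
      exact S.smul_mem_rotationSet hg hgp hg0 hX hm0.2.ne hm0.1.ne' (p := p) (by simp [hp]) hs0 hs1
    · rw [hm, hV]
      exact smul_ne_zero (inv_ne_zero hm1.ne') hstream.integral_Rperp_ne_zero
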